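/- arXiv:2409.10083 — 2 statements merged into one kernel-verified Lean document; each statement's English description precedes it below -/
import Mathlib

section
/- Let d ≥ 1 and β ≥ 1 be integers and L > 0. There exist a constant C₁ > 0 depending only on β, L and d, and a constant C₂ > 0 depending only on β, d and ‖f‖_∞, such that for every bounded probability density f ∈ S_L^p(β) and all n, ρ with min{ n, n·√(ρ/log₂ n) } ≥ C₂, the estimator f̂_{M̂} of the penalized-bias model-selection setup computed with the dyadic collection 𝓜 = { 1, 2, 4, …, 2^{⌊log₂((n^{1/d} − 1)/2)⌋} } satisfies E(‖f − f̂_{M̂}‖²) ≤ C₁ · max{ n^{−2β/(2β+d)}, ( n·√ρ / √(log₂ n) )^{−2β/(β+d)} }. -/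
open MeasureTheory ProbabilityTheory Real Complex Finset

noncomputable section

def cube (d : ℕ) : Set (Fin d → ℝ) := Set.Icc 0 1

def phi (d : ℕ) (k : Fin d → ℤ) (x : Fin d → ℝ) : ℂ :=
  Complex.exp (Complex.I * (2 * Real.pi) * ∑ i, (k i : ℂ) * (x i : ℂ))

def fCoeff (d : ℕ) (g : (Fin d → ℝ) → ℂ) (k : Fin d → ℤ) : ℂ :=
  ∫ x in cube d, g x * (starRingEnd ℂ) (phi d k x)

def box (d M : ℕ) : Finset (Fin d → ℤ) :=
  Fintype.piFinset fun _ => Finset.Icc (-(M : ℤ)) (M : ℤ)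

def projM (d M : ℕ) (g : (Fin d → ℝ) → ℂ) : (Fin d → ℝ) → ℂ :=
  fun x => ∑ k ∈ box d M, fCoeff d g k * phi d k x

def l2sq (d : ℕ) (g : (Fin d → ℝ) → ℂ) : ℝ :=
  ∫ x in cube d, ‖g x‖ ^ 2

def densMeasure (d : ℕ) (f : (Fin d → ℝ) → ℝ) : Measure (Fin d → ℝ) :=
  (volume.restrict (cube d)).withDensity fun x => ENNReal.ofReal (f x)

def IsDensity (d : ℕ) (f : (Fin d → ℝ) → ℝ) : Prop :=
  Measurable f ∧ (∀ x ∈ cube d, 0 ≤ f x) ∧ (∫ x in cube d, f x) = 1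

def stdCGauss : Measure ℂ :=
  ((gaussianReal 0 1).prod (gaussianReal 0 1)).map fun p => (p.1 : ℂ) + (p.2 : ℂ) * Complex.I

def empCoeff (d n : ℕ) (X : Fin n → (Fin d → ℝ)) (k : Fin d → ℤ) : ℂ :=
  (n : ℂ)⁻¹ * ∑ j, (starRingEnd ℂ) (phi d k (X j))

abbrev SampleSpace (d n M : ℕ) : Type :=
  (Fin n → (Fin d → ℝ)) × ((Fin d → Fin (2 * M + 1)) → ℂ)

def sampleMeasure (d n M : ℕ) (f : (Fin d → ℝ) → ℝ) : Measure (SampleSpace d n M) :=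
  (Measure.pi fun _ => densMeasure d f).prod (Measure.pi fun _ => stdCGauss)

def toIdx (d M : ℕ) (ν : Fin d → Fin (2 * M + 1)) : Fin d → ℤ :=
  fun i => (ν i : ℤ) - M

def privEst (d n M : ℕ) (σ : ℝ) (ω : SampleSpace d n M) : (Fin d → ℝ) → ℂ :=
  fun x => ∑ ν : Fin d → Fin (2 * M + 1),
    (empCoeff d n ω.1 (toIdx d M ν) + (σ : ℂ) * ω.2 ν) * phi d (toIdx d M ν) x

/-- Partial derivative in the `i`-th coordinate direction. -/
def pderiv (d : ℕ) (i : Fin d) (g : (Fin d → ℝ) → ℝ) : (Fin d → ℝ) → ℝ :=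
  fun x => deriv (fun t => g (Function.update x i t)) (x i)

/-- Iterated partial derivative `∂^α g` for the multi-index `α`. -/
def mderiv (d : ℕ) (α : Fin d → ℕ) (g : (Fin d → ℝ) → ℝ) : (Fin d → ℝ) → ℝ :=
  (List.finRange d).foldr (fun i h => (pderiv d i)^[α i] h) g

/-- The finite set of multi-indices `α ∈ ℕ^d` with `|α| = β`. -/
def multiIdx (d β : ℕ) : Finset (Fin d → ℕ) :=
  (Fintype.piFinset fun _ : Fin d => Finset.range (β + 1)).filter fun α => ∑ i, α i = β

/-- The periodic Sobolev ball `S_L^p(β)` of integer smoothness `β`: `f` is `β` times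
continuously differentiable, the total energy of the `β`-th derivatives is at most `L²`,
and all derivatives of order `< β` (including `f` itself) satisfy the periodic boundary
condition on `[0,1]^d`. -/
def SobolevP (d β : ℕ) (L : ℝ) (f : (Fin d → ℝ) → ℝ) : Prop :=
  ContDiff ℝ (β : ℕ∞) f ∧
  (∑ α ∈ multiIdx d β, ∫ x in cube d, (mderiv d α f x) ^ 2) ≤ L ^ 2 ∧
  ∀ α : Fin d → ℕ, (∑ i, α i) < β →
    ∀ x ∈ cube d, ∀ i : Fin d, (x i = 0 ∨ x i = 1) →
      mderiv d α f x = mderiv d α f (Function.update x i (1 - x i))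

/-- Sample space for model selection: data plus a fresh array of complex Gaussian
noises for each cut-off `M ∈ 𝓜`. -/
abbrev SelSpace (d n : ℕ) (𝓜 : Finset ℕ) : Type :=
  (Fin n → (Fin d → ℝ)) × ((M : 𝓜) → (Fin d → Fin (2 * (M : ℕ) + 1)) → ℂ)

/-- Law of the data (i.i.d. with density `f`) and of the independent Gaussian noises. -/
def selMeasure (d n : ℕ) (𝓜 : Finset ℕ) (f : (Fin d → ℝ) → ℝ) :
    Measure (SelSpace d n 𝓜) :=
  (Measure.pi fun _ => densMeasure d f).prod
    (Measure.pi fun _ => Measure.pi fun _ => stdCGauss)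

/-- The noise scale `σ_M = 2 √((2M+1)^d) / (n √(ρ/|𝓜|))`. -/
def sigmaSel (d n : ℕ) (𝓜 : Finset ℕ) (ρ : ℝ) (M : ℕ) : ℝ :=
  2 * Real.sqrt (((2 * M + 1 : ℕ) : ℝ) ^ d) / ((n : ℝ) * Real.sqrt (ρ / 𝓜.card))

/-- The private projection estimator `f̂_M` for a cut-off `M ∈ 𝓜`. -/
def selEst (d n : ℕ) (𝓜 : Finset ℕ) (ρ : ℝ) (M : 𝓜) (ω : SelSpace d n 𝓜) :
    (Fin d → ℝ) → ℂ :=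
  fun x => ∑ ν : Fin d → Fin (2 * (M : ℕ) + 1),
    (empCoeff d n ω.1 (toIdx d M ν) + (sigmaSel d n 𝓜 ρ M : ℂ) * ω.2 M ν) *
      phi d (toIdx d M ν) x

/-- `f̂_M` for a natural-number cut-off `M` (junk value `0` if `M ∉ 𝓜`). -/
def selEstN (d n : ℕ) (𝓜 : Finset ℕ) (ρ : ℝ) (M : ℕ) (ω : SelSpace d n 𝓜) :
    (Fin d → ℝ) → ℂ :=
  if h : M ∈ 𝓜 then selEst d n 𝓜 ρ ⟨M, h⟩ ω else 0

/-- Penalty `Λ⁽¹⁾(M) = 96 (2M+1)^d / n + 96 (2M+1)^{2d} / (n² ρ / |𝓜|)`. -/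
def lam1 (d n : ℕ) (𝓜 : Finset ℕ) (ρ : ℝ) (M : ℕ) : ℝ :=
  96 * ((2 * M + 1 : ℕ) : ℝ) ^ d / n +
    96 * ((2 * M + 1 : ℕ) : ℝ) ^ (2 * d) / ((n : ℝ) ^ 2 * (ρ / 𝓜.card))

/-- Penalty `Λ⁽²⁾(M) = Λ⁽¹⁾(M) + 16 (2M+1)^{2d} / (n² ρ / |𝓜|)`. -/
def lam2 (d n : ℕ) (𝓜 : Finset ℕ) (ρ : ℝ) (M : ℕ) : ℝ :=
  lam1 d n 𝓜 ρ M +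
    16 * ((2 * M + 1 : ℕ) : ℝ) ^ (2 * d) / ((n : ℝ) ^ 2 * (ρ / 𝓜.card))

/-- Estimated squared bias
`B²(M) = max_{M' ∈ 𝓜} (‖proj_{S_{M'}}(f̂_M) - f̂_{M'}‖² - Λ⁽¹⁾(M'))`. -/
def Bsq (d n : ℕ) (𝓜 : Finset ℕ) (ρ : ℝ) (M : ℕ) (ω : SelSpace d n 𝓜) : ℝ :=
  sSup ((fun M' : ℕ =>
    l2sq d (fun x => projM d M' (selEstN d n 𝓜 ρ M ω) x - selEstN d n 𝓜 ρ M' ω x)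
      - lam1 d n 𝓜 ρ M') '' ↑𝓜)

/-- `Msel` is a measurable argmin of `M ↦ B²(M) + Λ⁽²⁾(M)` over `𝓜`
(ties broken arbitrarily but measurably). -/
def IsSelectionRule (d n : ℕ) (𝓜 : Finset ℕ) (ρ : ℝ)
    (Msel : SelSpace d n 𝓜 → ℕ) : Prop :=
  Measurable Msel ∧ ∀ ω, Msel ω ∈ 𝓜 ∧ ∀ M ∈ 𝓜,
    Bsq d n 𝓜 ρ (Msel ω) ω + lam2 d n 𝓜 ρ (Msel ω)
      ≤ Bsq d n 𝓜 ρ M ω + lam2 d n 𝓜 ρ M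

/-- Essential supremum norm `‖f‖_∞` of `f` on `[0,1]^d`. -/
def supNorm (d : ℕ) (f : (Fin d → ℝ) → ℝ) : ℝ :=
  (eLpNorm (fun x => f x) ⊤ (volume.restrict (cube d))).toReal

/-- The dyadic collection of cut-offs `𝓜 = {1, 2, 4, …, 2^{⌊log₂((n^{1/d}-1)/2)⌋}}`. -/
def dyadic (d n : ℕ) : Finset ℕ :=
  Finset.image (fun j => 2 ^ j)
    (Finset.range (⌊Real.logb 2 (((n : ℝ) ^ ((1 : ℝ) / d) - 1) / 2)⌋₊ + 1))

section Parseval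

local instance : MeasureSpace UnitAddCircle := ⟨AddCircle.haarAddCircle⟩

/-- The representative in `(0, 1]^d` of a point of the torus. -/
def torusRep (d : ℕ) (t : UnitAddTorus (Fin d)) : Fin d → ℝ :=
  (UnitAddTorus.measurableEquivPiIoc (0 : Fin d → ℝ) t).1

theorem restrict_cube_eq (d : ℕ) :
    (volume.restrict (cube d)) = volume.restrict
      {x : Fin d → ℝ | ∀ i, x i ∈ Set.Ioc ((0 : Fin d → ℝ) i) ((0 : Fin d → ℝ) i + 1)} := by
  have h := Measure.univ_pi_Ioc_ae_eq_Icc (μ := fun _ : Fin d => (volume : Measure ℝ))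
    (f := 0) (g := 1)
  refine Measure.restrict_congr_set ?_
  refine h.symm.trans (Filter.EventuallyEq.of_eq ?_)
  ext x
  change x ∈ Set.univ.pi _ ↔ x ∈ {x : Fin d → ℝ | _}
  simp [Set.mem_pi]

theorem measurableSet_piIoc (d : ℕ) : MeasurableSet
    {x : Fin d → ℝ | ∀ i, x i ∈ Set.Ioc ((0 : Fin d → ℝ) i) ((0 : Fin d → ℝ) i + 1)} := by
  have : {x : Fin d → ℝ | ∀ i, x i ∈ Set.Ioc ((0 : Fin d → ℝ) i) ((0 : Fin d → ℝ) i + 1)}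
      = Set.pi Set.univ fun i => Set.Ioc ((0 : Fin d → ℝ) i) ((0 : Fin d → ℝ) i + 1) := by
    ext x; simp
  rw [this]
  exact MeasurableSet.univ_pi fun i => measurableSet_Ioc

theorem measurePreserving_torusRep (d : ℕ) :
    MeasurePreserving (torusRep d) volume (volume.restrict (cube d)) := by
  rw [restrict_cube_eq]
  refine MeasurePreserving.comp (measurePreserving_subtype_coe (measurableSet_piIoc d))
    (UnitAddTorus.measurePreserving_equivPiIoc (0 : Fin d → ℝ))

theorem measurableEmbedding_torusRep (d : ℕ) : MeasurableEmbedding (torusRep d) := by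
  refine MeasurableEmbedding.comp (MeasurableEmbedding.subtype_coe (measurableSet_piIoc d))
    (MeasurableEquiv.measurableEmbedding _)

theorem mFourier_eq_phi (d : ℕ) (k : Fin d → ℤ) (t : UnitAddTorus (Fin d)) :
    UnitAddTorus.mFourier k t = phi d k (torusRep d t) := by
  have h : ∀ i, ((torusRep d t i : ℝ) : UnitAddCircle) = t i := fun i =>
    congrFun ((UnitAddTorus.measurableEquivPiIoc (0 : Fin d → ℝ)).symm_apply_apply t) i
  simp only [UnitAddTorus.mFourier, ContinuousMap.coe_mk]
  simp_rw [← h, fourier_coe_apply]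
  rw [← Complex.exp_sum, phi, Finset.mul_sum]
  congr 1
  refine Finset.sum_congr rfl fun i _ => ?_
  simp
  ring

/-- Parseval's identity on the unit cube. -/
theorem hasSum_sq_fCoeff {d : ℕ} {g : (Fin d → ℝ) → ℂ}
    (hg : MemLp g 2 (volume.restrict (cube d))) :
    HasSum (fun k => ‖fCoeff d g k‖ ^ 2) (l2sq d g) := by
  have hF := hg.comp_measurePreserving (measurePreserving_torusRep d)
  have key := UnitAddTorus.hasSum_sq_mFourierCoeff (hF.toLp _)
  have h_cube_int : ∀ G : (Fin d → ℝ) → ℝ, ∫ t, G (torusRep d t) = ∫ x in cube d, G x := fun G =>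
    (measurePreserving_torusRep d).integral_comp (measurableEmbedding_torusRep d) G
  have hintC : ∀ G : (Fin d → ℝ) → ℂ, ∫ t, G (torusRep d t) = ∫ x in cube d, G x := fun G =>
    (measurePreserving_torusRep d).integral_comp (measurableEmbedding_torusRep d) G
  have h1 : ∫ t, ‖hF.toLp _ t‖ ^ 2 = l2sq d g := by
    rw [l2sq, ← h_cube_int]
    refine integral_congr_ae ?_
    filter_upwards [hF.coeFn_toLp] with t ht
    rw [ht]; rfl
  have h2 : ∀ k, UnitAddTorus.mFourierCoeff (hF.toLp _) k = fCoeff d g k := by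
    intro k
    rw [fCoeff, ← hintC, UnitAddTorus.mFourierCoeff]
    refine integral_congr_ae ?_
    filter_upwards [hF.coeFn_toLp] with t ht
    rw [ht, UnitAddTorus.mFourier_neg, mFourier_eq_phi, smul_eq_mul, mul_comm]
    rfl
  rw [h1] at key
  simpa only [h2] using key

end Parseval

theorem volume_cube (d : ℕ) : volume (cube d) = 1 := by
  rw [cube, Real.volume_Icc_pi]
  simp

theorem measurableSet_cube (d : ℕ) : MeasurableSet (cube d) := measurableSet_Icc

theorem isCompact_cube (d : ℕ) : IsCompact (cube d) := isCompact_Icc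

instance isProbabilityMeasure_restrict_cube (d : ℕ) :
    IsProbabilityMeasure (volume.restrict (cube d)) :=
  ⟨by rw [Measure.restrict_apply_univ, volume_cube]⟩

theorem contDiff_phi (d : ℕ) (k : Fin d → ℤ) : ContDiff ℝ ⊤ (phi d k) := by
  unfold phi
  refine ContDiff.cexp ?_
  refine contDiff_const.mul (ContDiff.sum fun i _ => contDiff_const.mul ?_)
  exact Complex.ofRealCLM.contDiff.comp (contDiff_apply ℝ ℝ i)

theorem continuous_phi (d : ℕ) (k : Fin d → ℤ) : Continuous (phi d k) :=
  (contDiff_phi d k).continuous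

theorem conj_phi (d : ℕ) (k : Fin d → ℤ) (x : Fin d → ℝ) :
    (starRingEnd ℂ) (phi d k x) = phi d (-k) x := by
  rw [phi, phi, ← Complex.exp_conj]
  congr 1
  simp [Complex.conj_ofReal]
  exact Or.inl (map_ofNat (starRingEnd ℂ) 2)

theorem norm_phi (d : ℕ) (k : Fin d → ℤ) (x : Fin d → ℝ) : ‖phi d k x‖ = 1 := by
  have : Complex.I * (2 * Real.pi) * ∑ i, (k i : ℂ) * (x i : ℂ)
      = ((2 * Real.pi * ∑ i, (k i : ℝ) * x i : ℝ) : ℂ) * Complex.I := by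
    push_cast; ring
  rw [phi, this, Complex.norm_exp_ofReal_mul_I]

theorem hasDerivAt_phi_update (d : ℕ) (k : Fin d → ℤ) (i : Fin d) (x : Fin d → ℝ) :
    HasDerivAt (fun t => phi d k (Function.update x i t))
      (2 * Real.pi * Complex.I * k i * phi d k x) (x i) := by
  have h1 : ∀ j, HasDerivAt (fun t => ((Function.update x i t j : ℝ) : ℂ))
      (((Pi.single i 1 : Fin d → ℝ) j : ℝ) : ℂ) (x i) := fun j =>
    ((hasDerivAt_pi.1 (hasDerivAt_update x i (x i))) j).ofReal_comp
  have h2 := (((HasDerivAt.fun_sum (u := Finset.univ)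
    fun j _ => (h1 j).const_mul (k j : ℂ)).const_mul (Complex.I * (2 * Real.pi)))).cexp
  simp only [Function.update_eq_self] at h2
  have h3 : ∑ j, (k j : ℂ) * (((Pi.single i 1 : Fin d → ℝ) j : ℝ) : ℂ) = k i := by
    rw [Finset.sum_eq_single i] <;> simp +contextual
  rw [h3] at h2
  refine HasDerivAt.congr_deriv h2 ?_
  rw [phi]; ring

theorem hasDerivAt_comp_update {E : Type*} [NormedAddCommGroup E] [NormedSpace ℝ E] {d : ℕ}
    {G : (Fin d → ℝ) → E} {x : Fin d → ℝ} (hG : DifferentiableAt ℝ G x) (i : Fin d) :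
    HasDerivAt (fun t => G (Function.update x i t)) (fderiv ℝ G x (Pi.single i 1)) (x i) := by
  have h := hasDerivAt_update x i (x i)
  have hx : Function.update x i (x i) = x := Function.update_eq_self i x
  have hG' : HasFDerivAt G (fderiv ℝ G x) (Function.update x i (x i)) := by
    rw [hx]; exact hG.hasFDerivAt
  exact hG'.comp_hasDerivAt (x i) h

theorem pderiv_eq_fderiv {d : ℕ} {h : (Fin d → ℝ) → ℝ} (hh : Differentiable ℝ h) (i : Fin d) :
    pderiv d i h = fun x => fderiv ℝ h x (Pi.single i 1) :=
  funext fun x => (hasDerivAt_comp_update (hh x) i).deriv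

theorem contDiff_pderiv {d m : ℕ} {h : (Fin d → ℝ) → ℝ} (hh : ContDiff ℝ ((m + 1 : ℕ) : ℕ∞) h)
    (i : Fin d) : ContDiff ℝ (m : ℕ∞) (pderiv d i h) := by
  rw [pderiv_eq_fderiv (hh.differentiable (by simp)) i]
  refine ContDiff.clm_apply (hh.fderiv_right ?_) contDiff_const
  simp

/-- The integral over the cube of a partial derivative of a periodic function vanishes. -/
theorem integral_fderiv_eq_zero_of_periodic {d : ℕ} {G : (Fin d → ℝ) → ℂ} (hG : ContDiff ℝ 1 G)
    (i : Fin d) (hper : ∀ x ∈ cube d, x i = 0 → G x = G (Function.update x i 1)) :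
    ∫ x in cube d, fderiv ℝ G x (Pi.single i 1) = 0 := by
  cases d with
  | zero => exact i.elim0
  | succ n =>
    have key := integral_divergence_of_hasFDerivAt_off_countable' (0 : Fin (n + 1) → ℝ) 1
      zero_le_one (fun j => if j = i then G else 0)
      (fun j => if j = i then fderiv ℝ G else 0) ∅ Set.countable_empty
      (fun j => by
        split_ifs
        · exact hG.continuous.continuousOn
        · exact continuousOn_const)
      (fun x _ j => by
        split_ifs
        · exact (hG.differentiable (by simp) x).hasFDerivAt
        · exact hasFDerivAt_const (0 : ℂ) x)
      (by
        refine Continuous.integrableOn_Icc ?_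
        refine continuous_finsetSum _ fun j _ => ?_
        split_ifs
        · exact (hG.continuous_fderiv (by simp)).clm_apply continuous_const
        · exact continuous_const)
    have hs : ∀ x : Fin (n + 1) → ℝ, ∑ j, (if j = i then fderiv ℝ G else 0) x (Pi.single j 1)
        = fderiv ℝ G x (Pi.single i 1) := by
      intro x
      rw [Finset.sum_eq_single i] <;> simp +contextual
    simp only [hs] at key
    rw [cube, key, Finset.sum_eq_single i]
    · simp only [if_true, sub_eq_zero]
      refine setIntegral_congr_fun measurableSet_Icc fun y hy => ?_
      have hmem : i.insertNth ((0 : Fin (n + 1) → ℝ) i) y ∈ cube (n + 1) := by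
        refine ⟨fun j => ?_, fun j => ?_⟩
        · refine Fin.succAboveCases i ?_ (fun j => ?_) j
          · simp
          · simpa using hy.1 j
        · refine Fin.succAboveCases i ?_ (fun j => ?_) j
          · simp
          · simpa using hy.2 j
      have := hper _ hmem (by simp)
      rw [Fin.update_insertNth] at this
      exact this.symm
    · intro j _ hj
      simp [hj]
    · simp

theorem fCoeff_pderiv {d : ℕ} {h : (Fin d → ℝ) → ℝ} (hh : ContDiff ℝ 1 h) (i : Fin d)
    (hper : ∀ x ∈ cube d, (x i = 0 ∨ x i = 1) → h x = h (Function.update x i (1 - x i)))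
    (k : Fin d → ℤ) :
    fCoeff d (fun x => (pderiv d i h x : ℂ)) k
      = 2 * Real.pi * Complex.I * k i * fCoeff d (fun x => (h x : ℂ)) k := by
  have hdiff : Differentiable ℝ h := hh.differentiable (by simp)
  have hhC : ContDiff ℝ 1 fun x => (h x : ℂ) := Complex.ofRealCLM.contDiff.comp hh
  have hφ : ContDiff ℝ 1 (phi d (-k)) := (contDiff_phi d (-k)).of_le le_top
  have hG : ContDiff ℝ 1 fun x => (h x : ℂ) * phi d (-k) x := hhC.mul hφ
  have hphiper : ∀ x : Fin d → ℝ, x i = 0 → phi d (-k) x = phi d (-k) (Function.update x i 1) := by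
    intro x hx
    have hsum : ∑ j, ((-k) j : ℂ) * ((Function.update x i 1 j : ℝ) : ℂ)
        = (∑ j, ((-k) j : ℂ) * (x j : ℂ)) + ((-k) i : ℤ) := by
      rw [← Finset.add_sum_erase _ _ (Finset.mem_univ i),
        ← Finset.add_sum_erase (a := i) _ (fun j => ((-k) j : ℂ) * (x j : ℂ)) (Finset.mem_univ i)]
      rw [Finset.sum_congr rfl fun j hj => by
        rw [Function.update_of_ne (Finset.ne_of_mem_erase hj)]]
      simp [hx]
      ring
    simp only [phi]
    rw [hsum, mul_add, Complex.exp_add,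
      show Complex.I * (2 * Real.pi) * (((-k) i : ℤ) : ℂ)
        = (((-k) i : ℤ) : ℂ) * (2 * Real.pi * Complex.I) by ring,
      Complex.exp_int_mul_two_pi_mul_I, mul_one]
  have h0 := integral_fderiv_eq_zero_of_periodic hG i fun x hx hxi => by
    rw [hper x hx (Or.inl hxi), hphiper x hxi, hxi, sub_zero]
  have hder : ∀ x, fderiv ℝ (fun x => (h x : ℂ) * phi d (-k) x) x (Pi.single i 1)
      = (pderiv d i h x : ℂ) * phi d (-k) x
        - 2 * Real.pi * Complex.I * k i * ((h x : ℂ) * phi d (-k) x) := by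
    intro x
    have e1 := hasDerivAt_comp_update (hG.differentiable (by simp) x) i
    have e2 := (hasDerivAt_comp_update (hdiff x) i).ofReal_comp.mul
      (hasDerivAt_phi_update d (-k) i x)
    rw [Function.update_eq_self] at e2
    rw [e1.unique e2, pderiv_eq_fderiv hdiff]
    simp only [Pi.neg_apply, Int.cast_neg]
    ring
  have hcont1 : Continuous fun x => (pderiv d i h x : ℂ) * phi d (-k) x := by
    rw [pderiv_eq_fderiv hdiff]
    exact (Complex.continuous_ofReal.comp
      ((hh.continuous_fderiv (by simp)).clm_apply continuous_const)).mul (continuous_phi d _)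
  have hcont2 : Continuous fun x => (h x : ℂ) * phi d (-k) x := hG.continuous
  simp only [hder] at h0
  rw [integral_sub, integral_const_mul, sub_eq_zero] at h0
  · simpa only [fCoeff, conj_phi] using h0
  · exact hcont1.integrableOn_Icc
  · exact (hcont2.integrableOn_Icc (μ := volume)).const_mul _

theorem mderiv_single (d : ℕ) (i : Fin d) (j : ℕ) (f : (Fin d → ℝ) → ℝ) :
    mderiv d (Pi.single i j) f = (pderiv d i)^[j] f := by
  have key : ∀ l : List (Fin d), l.Nodup →
      l.foldr (fun i' h => (pderiv d i')^[(Pi.single i j : Fin d → ℕ) i'] h) f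
        = if i ∈ l then (pderiv d i)^[j] f else f := by
    intro l
    induction l with
    | nil => simp
    | cons a l ih =>
      intro hl
      rw [List.nodup_cons] at hl
      rw [List.foldr_cons, ih hl.2]
      by_cases ha : a = i
      · subst ha; simp [hl.1]
      · simp [ha, Ne.symm ha]
  rw [mderiv, key _ (List.nodup_finRange d)]
  simp

theorem contDiff_iterate_pderiv {d β : ℕ} {f : (Fin d → ℝ) → ℝ} (hf : ContDiff ℝ (β : ℕ∞) f)
    (i : Fin d) : ∀ j m : ℕ, j + m = β → ContDiff ℝ (m : ℕ∞) ((pderiv d i)^[j] f) := by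
  intro j
  induction j with
  | zero => rintro m rfl; simpa using hf
  | succ j ih =>
    intro m hm
    rw [Function.iterate_succ_apply']
    exact contDiff_pderiv (ih (m + 1) (by omega)) i

theorem fCoeff_iterate_pderiv {d β : ℕ} {L : ℝ} {f : (Fin d → ℝ) → ℝ} (hf : SobolevP d β L f)
    (i : Fin d) (k : Fin d → ℤ) : ∀ j ≤ β,
    fCoeff d (fun x => (((pderiv d i)^[j] f) x : ℂ)) k
      = (2 * Real.pi * Complex.I * k i) ^ j * fCoeff d (fun x => (f x : ℂ)) k := by
  intro j
  induction j with
  | zero => simp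
  | succ j ih =>
    intro hj
    have hper := hf.2.2 (Pi.single i j) (by simpa using hj)
    simp only [mderiv_single] at hper
    have hC : ContDiff ℝ 1 ((pderiv d i)^[j] f) :=
      (contDiff_iterate_pderiv hf.1 i j (β - j) (by omega)).of_le (by
        have : 1 ≤ β - j := by omega
        exact_mod_cast this)
    simp only [Function.iterate_succ_apply']
    rw [fCoeff_pderiv hC i (fun x hx hxi => hper x hx i hxi) k, ih (by omega)]
    ring

theorem memLp_of_continuous {d : ℕ} {g : (Fin d → ℝ) → ℂ} (hg : Continuous g) :
    MemLp g 2 (volume.restrict (cube d)) := by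
  obtain ⟨C, hC⟩ := (isCompact_cube d).exists_bound_of_continuousOn hg.continuousOn
  refine MemLp.of_bound hg.aestronglyMeasurable C ?_
  filter_upwards [ae_restrict_mem (measurableSet_cube d)] with x hx using hC x hx

theorem integrable_mul_conj_phi {d : ℕ} {g : (Fin d → ℝ) → ℂ}
    (hg : MemLp g 2 (volume.restrict (cube d))) (k : Fin d → ℤ) :
    IntegrableOn (fun x => g x * (starRingEnd ℂ) (phi d k x)) (cube d) := by
  refine Integrable.mul_bdd (c := 1) (hg.integrable (by norm_num)) ?_ ?_
  · exact (Complex.continuous_conj.comp (continuous_phi d k)).aestronglyMeasurable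
  · exact Filter.Eventually.of_forall fun x => by simp [norm_phi]

theorem fCoeff_sub {d : ℕ} {g h : (Fin d → ℝ) → ℂ} (hg : MemLp g 2 (volume.restrict (cube d)))
    (hh : MemLp h 2 (volume.restrict (cube d))) (k : Fin d → ℤ) :
    fCoeff d (fun x => g x - h x) k = fCoeff d g k - fCoeff d h k := by
  simp only [fCoeff, sub_mul]
  exact integral_sub (integrable_mul_conj_phi hg k) (integrable_mul_conj_phi hh k)

theorem integral_phi (d : ℕ) (k : Fin d → ℤ) :
    ∫ x in cube d, phi d k x = if k = 0 then 1 else 0 := by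
  split_ifs with hk
  · subst hk
    simp [phi, Measure.real]
  · obtain ⟨i, hi⟩ := Function.ne_iff.1 hk
    have h := fCoeff_pderiv (d := d) (h := fun _ => 1) contDiff_const i (fun _ _ _ => rfl) (-k)
    have h0 : pderiv d i (fun _ => (1 : ℝ)) = fun _ => 0 := by
      funext x; simp [pderiv]
    have hpi : (2 * (Real.pi : ℂ) * Complex.I * ((-k) i : ℤ)) ≠ 0 := by
      have : (k i : ℂ) ≠ 0 := by exact_mod_cast hi
      simp [this, Real.pi_ne_zero]
    rw [h0] at h
    simp only [fCoeff, conj_phi, neg_neg, Complex.ofReal_one, one_mul, Complex.ofReal_zero,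
      zero_mul, integral_zero] at h
    exact (mul_eq_zero.1 h.symm).resolve_left hpi

theorem phi_mul_conj_phi (d : ℕ) (j k : Fin d → ℤ) (x : Fin d → ℝ) :
    phi d j x * (starRingEnd ℂ) (phi d k x) = phi d (j - k) x := by
  rw [conj_phi, phi, phi, phi, ← Complex.exp_add, ← mul_add, ← Finset.sum_add_distrib]
  congr 2
  refine Finset.sum_congr rfl fun i _ => ?_
  push_cast [Pi.sub_apply, Pi.neg_apply]
  ring

/-- The trigonometric polynomial with frequencies in `s` and coefficients `c`. -/
def trigPoly (d : ℕ) (s : Finset (Fin d → ℤ)) (c : (Fin d → ℤ) → ℂ) (x : Fin d → ℝ) : ℂ :=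
  ∑ k ∈ s, c k * phi d k x

theorem continuous_trigPoly (d : ℕ) (s : Finset (Fin d → ℤ)) (c : (Fin d → ℤ) → ℂ) :
    Continuous (trigPoly d s c) :=
  continuous_finsetSum _ fun k _ => continuous_const.mul (continuous_phi d k)

theorem memLp_trigPoly (d : ℕ) (s : Finset (Fin d → ℤ)) (c : (Fin d → ℤ) → ℂ) :
    MemLp (trigPoly d s c) 2 (volume.restrict (cube d)) :=
  memLp_of_continuous (continuous_trigPoly d s c)

theorem fCoeff_trigPoly (d : ℕ) (s : Finset (Fin d → ℤ)) (c : (Fin d → ℤ) → ℂ)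
    (k : Fin d → ℤ) : fCoeff d (trigPoly d s c) k = if k ∈ s then c k else 0 := by
  simp only [fCoeff, trigPoly, Finset.sum_mul, mul_assoc, phi_mul_conj_phi]
  rw [integral_finsetSum]
  · simp only [integral_const_mul, integral_phi, sub_eq_zero]
    simp
  · intro j _
    exact (((continuous_phi d _).integrableOn_Icc (μ := volume))).const_mul _

theorem l2sq_trigPoly (d : ℕ) (s : Finset (Fin d → ℤ)) (c : (Fin d → ℤ) → ℂ) :
    l2sq d (trigPoly d s c) = ∑ k ∈ s, ‖c k‖ ^ 2 := by
  have h := hasSum_sq_fCoeff (memLp_trigPoly d s c)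
  have h' : HasSum (fun k => ‖fCoeff d (trigPoly d s c) k‖ ^ 2)
      (∑ k ∈ s, ‖fCoeff d (trigPoly d s c) k‖ ^ 2) :=
    hasSum_sum_of_ne_finset_zero fun k hk => by simp [fCoeff_trigPoly, hk]
  rw [h.unique h']
  refine Finset.sum_congr rfl fun k hk => ?_
  simp [fCoeff_trigPoly, hk]

theorem l2sq_nonneg (d : ℕ) (g : (Fin d → ℝ) → ℂ) : 0 ≤ l2sq d g :=
  integral_nonneg fun _ => by positivity

theorem l2sq_sub_comm (d : ℕ) (g h : (Fin d → ℝ) → ℂ) :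
    l2sq d (fun x => g x - h x) = l2sq d (fun x => h x - g x) := by
  simp only [l2sq, norm_sub_rev]

theorem l2sq_sub_le {d : ℕ} {a b c : (Fin d → ℝ) → ℂ} (ha : MemLp a 2 (volume.restrict (cube d)))
    (hb : MemLp b 2 (volume.restrict (cube d))) (hc : MemLp c 2 (volume.restrict (cube d))) :
    l2sq d (fun x => a x - c x)
      ≤ 2 * l2sq d (fun x => a x - b x) + 2 * l2sq d (fun x => b x - c x) := by
  have hi : ∀ {u v : (Fin d → ℝ) → ℂ}, MemLp u 2 (volume.restrict (cube d)) →
      MemLp v 2 (volume.restrict (cube d)) →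
      Integrable (fun x => ‖u x - v x‖ ^ 2) (volume.restrict (cube d)) := fun hu hv =>
    (hu.sub hv).integrable_norm_pow (by norm_num)
  simp only [l2sq]
  rw [← integral_const_mul, ← integral_const_mul,
    ← integral_add ((hi ha hb).const_mul 2) ((hi hb hc).const_mul 2)]
  refine integral_mono (hi ha hc) (((hi ha hb).const_mul 2).add ((hi hb hc).const_mul 2)) ?_
  intro x
  have h1 : ‖a x - c x‖ ≤ ‖a x - b x‖ + ‖b x - c x‖ := norm_sub_le_norm_sub_add_norm_sub _ _ _
  have h0 := norm_nonneg (a x - c x)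
  simp only
  nlinarith [sq_nonneg (‖a x - b x‖ - ‖b x - c x‖)]

theorem projM_eq_trigPoly (d M : ℕ) (g : (Fin d → ℝ) → ℂ) :
    projM d M g = trigPoly d (box d M) (fCoeff d g) := rfl

theorem box_mono (d : ℕ) {M M' : ℕ} (h : M ≤ M') : box d M ⊆ box d M' := by
  refine Fintype.piFinset_subset _ _ fun _ => Finset.Icc_subset_Icc ?_ ?_ <;> omega

theorem projM_trigPoly {d M M' : ℕ} (h : M ≤ M') (c : (Fin d → ℤ) → ℂ) :
    projM d M' (trigPoly d (box d M) c) = trigPoly d (box d M) c := by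
  funext x
  rw [projM_eq_trigPoly, trigPoly, trigPoly, ← Finset.sum_subset (box_mono d h)]
  · refine Finset.sum_congr rfl fun k hk => ?_
    rw [fCoeff_trigPoly, if_pos hk]
  · intro k _ hk
    rw [fCoeff_trigPoly, if_neg hk, zero_mul]

theorem l2sq_projM_sub_le {d : ℕ} (M : ℕ) {g h : (Fin d → ℝ) → ℂ}
    (hg : MemLp g 2 (volume.restrict (cube d))) (hh : MemLp h 2 (volume.restrict (cube d))) :
    l2sq d (fun x => projM d M g x - projM d M h x) ≤ l2sq d (fun x => g x - h x) := by
  have e : (fun x => projM d M g x - projM d M h x)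
      = trigPoly d (box d M) (fCoeff d (fun x => g x - h x)) := by
    funext x
    simp only [projM, trigPoly, ← Finset.sum_sub_distrib, ← sub_mul, fCoeff_sub hg hh]
  rw [e, l2sq_trigPoly]
  exact sum_le_hasSum _ (fun _ _ => by positivity) (hasSum_sq_fCoeff (hg.sub hh))

theorem mem_box {d M : ℕ} {k : Fin d → ℤ} : k ∈ box d M ↔ ∀ i, -(M : ℤ) ≤ k i ∧ k i ≤ M := by
  simp [_root_.box]

/-- Truncation bias of a periodic Sobolev function. -/
theorem l2sq_sub_projM_le {d β : ℕ} {L : ℝ} (hβ : 1 ≤ β) {f : (Fin d → ℝ) → ℝ}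
    (hf : SobolevP d β L f) {M : ℕ} (hM : 1 ≤ M) :
    l2sq d (fun x => (f x : ℂ) - projM d M (fun y => (f y : ℂ)) x)
      ≤ L ^ 2 * ((M : ℝ) ^ (2 * β))⁻¹ := by
  have hfc : Continuous fun x => (f x : ℂ) := Complex.continuous_ofReal.comp hf.1.continuous
  have hfL := memLp_of_continuous hfc
  have hM0 : (0 : ℝ) < M := by exact_mod_cast hM
  have hpc : ∀ i, Continuous fun x => (((pderiv d i)^[β] f) x : ℂ) := fun i =>
    Complex.continuous_ofReal.comp (contDiff_iterate_pderiv hf.1 i β 0 (by simp)).continuous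
  have hcoef : ∀ k, fCoeff d (fun x => (f x : ℂ) - projM d M (fun y => (f y : ℂ)) x) k
      = if k ∈ box d M then 0 else fCoeff d (fun x => (f x : ℂ)) k := by
    intro k
    rw [projM_eq_trigPoly, fCoeff_sub hfL (memLp_trigPoly d _ _), fCoeff_trigPoly]
    split_ifs <;> simp
  have hs1 := hasSum_sq_fCoeff (hfL.sub (memLp_trigPoly d (box d M) (fCoeff d fun x => (f x : ℂ))))
  have hs2 := (hasSum_sum (s := Finset.univ) fun (i : Fin d) _ =>
    hasSum_sq_fCoeff (memLp_of_continuous (hpc i))).mul_left ((M : ℝ) ^ (2 * β))⁻¹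
  have hle : l2sq d (fun x => (f x : ℂ) - projM d M (fun y => (f y : ℂ)) x)
      ≤ ((M : ℝ) ^ (2 * β))⁻¹ *
        ∑ i : Fin d, l2sq d (fun x => (((pderiv d i)^[β] f) x : ℂ)) := by
    refine hasSum_le ?_ hs1 hs2
    intro k
    have hk := hcoef k
    change fCoeff d ((fun x => (f x : ℂ)) - trigPoly d (box d M) (fCoeff d fun x => (f x : ℂ))) k
      = _ at hk
    rw [hk]
    split_ifs with hkM
    · rw [norm_zero, zero_pow two_ne_zero]
      exact mul_nonneg (by positivity) (Finset.sum_nonneg fun _ _ => sq_nonneg _)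
    · rw [mem_box] at hkM
      push Not at hkM
      obtain ⟨i, hi⟩ := hkM
      have habs : (M : ℝ) ≤ |(k i : ℝ)| := by
        by_cases h1 : -(M : ℤ) ≤ k i
        · have := hi h1
          have h3 : (M : ℝ) ≤ k i := by exact_mod_cast this.le
          exact h3.trans (le_abs_self _)
        · have h3 : (k i : ℝ) ≤ -(M : ℝ) := by
            have : k i ≤ -(M : ℤ) := by omega
            exact_mod_cast this
          exact (le_neg.1 h3).trans (neg_le_abs _)
      have hmul : (M : ℝ) ^ β ≤ ‖(2 * (Real.pi : ℂ) * Complex.I * k i) ^ β‖ := by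
        rw [norm_pow]
        refine pow_le_pow_left₀ hM0.le ?_ _
        have : ‖(2 * (Real.pi : ℂ) * Complex.I * k i)‖ = 2 * Real.pi * |(k i : ℝ)| := by
          simp [abs_of_pos Real.pi_pos]
        rw [this]
        nlinarith [Real.pi_gt_three, abs_nonneg (k i : ℝ)]
      have hterm : ‖fCoeff d (fun x => (f x : ℂ)) k‖ ^ 2 ≤ ((M : ℝ) ^ (2 * β))⁻¹ *
          ‖fCoeff d (fun x => (((pderiv d i)^[β] f) x : ℂ)) k‖ ^ 2 := by
        rw [fCoeff_iterate_pderiv hf i k β le_rfl, norm_mul, mul_pow, le_inv_mul_iff₀ (by positivity),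
          mul_comm 2 β, pow_mul]
        gcongr
      refine hterm.trans ?_
      gcongr
      exact Finset.single_le_sum (f := fun i =>
        ‖fCoeff d (fun x => (((pderiv d i)^[β] f) x : ℂ)) k‖ ^ 2)
        (fun _ _ => by positivity) (Finset.mem_univ i)
  refine hle.trans ?_
  rw [mul_comm]
  gcongr
  refine le_trans ?_ hf.2.1
  have hinj : Set.InjOn (fun i : Fin d => (Pi.single i β : Fin d → ℕ)) (Finset.univ : Finset (Fin d)) := by
    intro i _ j _ hij
    by_contra hne
    have := congrFun hij i
    simp [hne] at this
    omega
  have himg : Finset.univ.image (fun i : Fin d => (Pi.single i β : Fin d → ℕ)) ⊆ multiIdx d β := by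
    intro α hα
    obtain ⟨i, -, rfl⟩ := Finset.mem_image.1 hα
    rw [multiIdx, Finset.mem_filter]
    refine ⟨?_, by simp⟩
    rw [Fintype.mem_piFinset]
    intro j
    rw [Finset.mem_range, Pi.single_apply]
    split_ifs <;> omega
  refine le_trans (le_of_eq ?_) (Finset.sum_le_sum_of_subset_of_nonneg himg fun α _ _ =>
    integral_nonneg fun x => sq_nonneg _)
  rw [Finset.sum_image hinj]
  refine Finset.sum_congr rfl fun i _ => ?_
  simp only [mderiv_single, l2sq, Complex.norm_real, Real.norm_eq_abs, sq_abs]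

/-- The array index in `Fin d → Fin (2 * M + 1)` of a frequency in the box. -/
def unIdx (d M : ℕ) (k : Fin d → ℤ) : Fin d → Fin (2 * M + 1) :=
  fun i => Fin.ofNat (2 * M + 1) (k i + M).toNat

theorem unIdx_toIdx {d M : ℕ} (ν : Fin d → Fin (2 * M + 1)) : unIdx d M (toIdx d M ν) = ν := by
  funext i
  ext
  simp [unIdx, toIdx]

theorem toIdx_unIdx {d M : ℕ} {k : Fin d → ℤ} (hk : k ∈ box d M) :
    toIdx d M (unIdx d M k) = k := by
  funext i
  have := mem_box.1 hk i
  have h : (k i + M).toNat < 2 * M + 1 := by omega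
  simp only [unIdx, toIdx, Fin.val_ofNat, Nat.mod_eq_of_lt h]
  omega

theorem toIdx_mem_box {d M : ℕ} (ν : Fin d → Fin (2 * M + 1)) : toIdx d M ν ∈ box d M := by
  rw [mem_box]
  intro i
  have := (ν i).2
  simp only [toIdx]
  omega

theorem sum_toIdx {E : Type*} [AddCommMonoid E] {d M : ℕ}
    (F : (Fin d → ℤ) → (Fin d → Fin (2 * M + 1)) → E) :
    ∑ ν, F (toIdx d M ν) ν = ∑ k ∈ box d M, F k (unIdx d M k) := by
  refine Finset.sum_bij' (fun ν _ => toIdx d M ν) (fun k _ => unIdx d M k)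
    (fun ν _ => toIdx_mem_box ν) (fun _ _ => Finset.mem_univ _) (fun ν _ => unIdx_toIdx ν)
    (fun k hk => toIdx_unIdx hk) (fun ν _ => ?_)
  rw [unIdx_toIdx]

theorem selEst_eq_trigPoly (d n : ℕ) (𝓜 : Finset ℕ) (ρ : ℝ) (M : 𝓜) (ω : SelSpace d n 𝓜) :
    selEst d n 𝓜 ρ M ω = trigPoly d (box d M) fun k =>
      empCoeff d n ω.1 k + (sigmaSel d n 𝓜 ρ M : ℂ) * ω.2 M (unIdx d M k) := by
  funext x
  exact sum_toIdx fun k ν => (empCoeff d n ω.1 k + (sigmaSel d n 𝓜 ρ M : ℂ) * ω.2 M ν) * phi d k x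

theorem exists_selEstN_eq_trigPoly {d n : ℕ} {𝓜 : Finset ℕ} (ρ : ℝ) {M : ℕ} (hM : M ∈ 𝓜)
    (ω : SelSpace d n 𝓜) : ∃ c, selEstN d n 𝓜 ρ M ω = trigPoly d (box d M) c :=
  ⟨_, by rw [selEstN, dif_pos hM]; exact selEst_eq_trigPoly d n 𝓜 ρ ⟨M, hM⟩ ω⟩

theorem l2sq_projM_sub_selEstN {d n : ℕ} {𝓜 : Finset ℕ} (ρ : ℝ) {M : ℕ} (hM : M ∈ 𝓜)
    (ω : SelSpace d n 𝓜) (g : (Fin d → ℝ) → ℂ) :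
    l2sq d (fun x => projM d M g x - selEstN d n 𝓜 ρ M ω x)
      = ∑ ν, ‖fCoeff d g (toIdx d M ν) - (empCoeff d n ω.1 (toIdx d M ν)
          + (sigmaSel d n 𝓜 ρ M : ℂ) * ω.2 ⟨M, hM⟩ ν)‖ ^ 2 := by
  rw [selEstN, dif_pos hM, selEst_eq_trigPoly, sum_toIdx fun k ν =>
    ‖fCoeff d g k - (empCoeff d n ω.1 k + (sigmaSel d n 𝓜 ρ M : ℂ) * ω.2 ⟨M, hM⟩ ν)‖ ^ 2]
  rw [← l2sq_trigPoly]
  congr 1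
  funext x
  simp only [projM, trigPoly, ← Finset.sum_sub_distrib, ← sub_mul]

theorem lam1_nonneg (d n : ℕ) (𝓜 : Finset ℕ) {ρ : ℝ} (hρ : 0 < ρ) (M : ℕ) :
    0 ≤ lam1 d n 𝓜 ρ M := by
  unfold lam1; positivity

theorem lam1_mono (d n : ℕ) (𝓜 : Finset ℕ) {ρ : ℝ} (hρ : 0 < ρ) {M M' : ℕ} (h : M ≤ M') :
    lam1 d n 𝓜 ρ M ≤ lam1 d n 𝓜 ρ M' := by
  unfold lam1
  gcongr

theorem lam1_le_lam2 (d n : ℕ) (𝓜 : Finset ℕ) {ρ : ℝ} (hρ : 0 < ρ) (M : ℕ) :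
    lam1 d n 𝓜 ρ M ≤ lam2 d n 𝓜 ρ M := by
  unfold lam2
  have : 0 ≤ 16 * ((2 * M + 1 : ℕ) : ℝ) ^ (2 * d) / ((n : ℝ) ^ 2 * (ρ / 𝓜.card)) := by positivity
  linarith

/-- Deterministic oracle inequality for the penalized-bias selection. -/
theorem oracle_inequality {d n : ℕ} {𝓜 : Finset ℕ} {ρ : ℝ} (hρ : 0 < ρ)
    (hone : 1 ∈ 𝓜) (hpos : ∀ M ∈ 𝓜, 1 ≤ M) {g : (Fin d → ℝ) → ℂ}
    (hg : MemLp g 2 (volume.restrict (cube d))) (ω : SelSpace d n 𝓜) {q : ℕ → ℝ}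
    (hq0 : ∀ M ∈ 𝓜, 0 ≤ q M)
    (hq : ∀ M ∈ 𝓜, 2 * l2sq d (fun x => projM d M g x - selEstN d n 𝓜 ρ M ω x)
      ≤ lam1 d n 𝓜 ρ M + q M)
    {N : ℕ} (hN : N ∈ 𝓜) {M : ℕ} (hM : M ∈ 𝓜)
    (hmin : Bsq d n 𝓜 ρ N ω + lam2 d n 𝓜 ρ N ≤ Bsq d n 𝓜 ρ M ω + lam2 d n 𝓜 ρ M) :
    l2sq d (fun x => g x - selEstN d n 𝓜 ρ N ω x)
      ≤ 20 * l2sq d (fun x => g x - projM d M g x) + 14 * lam2 d n 𝓜 ρ M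
        + 14 * ∑ M' ∈ 𝓜, q M' := by
  have hmem : ∀ {K}, K ∈ 𝓜 → MemLp (selEstN d n 𝓜 ρ K ω) 2 (volume.restrict (cube d)) := by
    intro K hK
    obtain ⟨c, hc⟩ := exists_selEstN_eq_trigPoly ρ hK ω
    rw [hc]; exact memLp_trigPoly d _ c
  have hproj : ∀ (K : ℕ) (h : (Fin d → ℝ) → ℂ), MemLp (projM d K h) 2 (volume.restrict (cube d)) :=
    fun K h => memLp_trigPoly d _ _
  have hQ : ∀ K ∈ 𝓜, q K ≤ ∑ M' ∈ 𝓜, q M' := fun K hK => Finset.single_le_sum hq0 hK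
  have hBle : ∀ K K' : ℕ, K' ∈ 𝓜 →
      l2sq d (fun x => projM d K' (selEstN d n 𝓜 ρ K ω) x - selEstN d n 𝓜 ρ K' ω x)
        - lam1 d n 𝓜 ρ K' ≤ Bsq d n 𝓜 ρ K ω := fun K K' hK' =>
    le_csSup (𝓜.finite_toSet.image _).bddAbove ⟨K', hK', rfl⟩
  have hMerr : l2sq d (fun x => g x - selEstN d n 𝓜 ρ M ω x)
      ≤ 2 * l2sq d (fun x => g x - projM d M g x) + lam1 d n 𝓜 ρ M + ∑ M' ∈ 𝓜, q M' := by
    have h1 := l2sq_sub_le hg (hproj M g) (hmem hM)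
    have h2 := hq M hM
    have h3 := hQ M hM
    linarith
  have hBM : Bsq d n 𝓜 ρ M ω ≤ 2 * l2sq d (fun x => g x - selEstN d n 𝓜 ρ M ω x)
      + ∑ M' ∈ 𝓜, q M' := by
    refine csSup_le ⟨_, 1, hone, rfl⟩ ?_
    rintro _ ⟨K, hK, rfl⟩
    simp only
    have h1 := l2sq_sub_le (hproj K (selEstN d n 𝓜 ρ M ω)) (hproj K g) (hmem hK)
    have h2 := l2sq_projM_sub_le K (hmem hM) hg
    rw [l2sq_sub_comm d (selEstN d n 𝓜 ρ M ω) g] at h2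
    have h3 := hq K hK
    have h4 := hQ K hK
    linarith
  have hBN : -lam1 d n 𝓜 ρ M ≤ Bsq d n 𝓜 ρ N ω := by
    have h1 := hBle N 1 hone
    have h2 := l2sq_nonneg d
      (fun x => projM d 1 (selEstN d n 𝓜 ρ N ω) x - selEstN d n 𝓜 ρ 1 ω x)
    have h3 := lam1_mono d n 𝓜 hρ (hpos M hM)
    linarith
  have hb := l2sq_nonneg d fun x => g x - projM d M g x
  have h0 := Finset.sum_nonneg hq0
  have hl0 := lam1_nonneg d n 𝓜 hρ M
  have hlM := lam1_le_lam2 d n 𝓜 hρ M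
  have hlN := lam1_le_lam2 d n 𝓜 hρ N
  have hlN0 := lam1_nonneg d n 𝓜 hρ N
  have hdiff : l2sq d (fun x => selEstN d n 𝓜 ρ M ω x - selEstN d n 𝓜 ρ N ω x)
      ≤ 8 * l2sq d (fun x => g x - projM d M g x) + 6 * lam2 d n 𝓜 ρ M
        + 6 * ∑ M' ∈ 𝓜, q M' := by
    rcases le_total M N with hle | hle
    · have h1 := hBle M N hN
      obtain ⟨c, hc⟩ := exists_selEstN_eq_trigPoly ρ hM ω
      rw [hc, projM_trigPoly hle c, ← hc] at h1
      linarith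
    · have h1 := hBle N M hM
      obtain ⟨c, hc⟩ := exists_selEstN_eq_trigPoly ρ hN ω
      rw [hc, projM_trigPoly hle c, ← hc, l2sq_sub_comm] at h1
      linarith
  have htri := l2sq_sub_le hg (hmem hM) (hmem hN)
  linarith

section DegenerateSum

set_option linter.unusedSectionVars false

variable {E H : Type*} [MeasurableSpace E] [NormedAddCommGroup H] [InnerProductSpace ℂ H]
  [MeasurableSpace H] [BorelSpace H] [SecondCountableTopology H]

theorem integrable_of_measurable_of_bound {μ : Measure E} [IsFiniteMeasure μ] {h : E → ℝ} {C : ℝ}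
    (hm : Measurable h) (hC : ∀ x, |h x| ≤ C) : Integrable h μ :=
  Integrable.of_bound hm.aestronglyMeasurable C (Filter.Eventually.of_forall hC)

theorem norm_sum_le_card_mul {g : E → H} {B : ℝ} (hB : ∀ x, ‖g x‖ ≤ B) {n : ℕ}
    (x : Fin n → E) : ‖∑ j, g (x j)‖ ≤ n * B := by
  refine (norm_sum_le _ _).trans ((Finset.sum_le_sum fun j _ => hB (x j)).trans ?_)
  simp

theorem measurable_sum_comp {g : E → H} (hg : Measurable g) (n : ℕ) :
    Measurable fun x : Fin n → E => ∑ j, g (x j) :=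
  Finset.measurable_fun_sum _ fun j _ => hg.comp (measurable_pi_apply j)

theorem integral_fin_succ {μ : Measure E} [IsProbabilityMeasure μ] {n : ℕ}
    {G : E → (Fin n → E) → ℝ} {C : ℝ} (hm : Measurable fun p : E × (Fin n → E) => G p.1 p.2)
    (hC : ∀ x y, |G x y| ≤ C) :
    ∫ x : Fin (n + 1) → E, G (x 0) (fun j => x j.succ) ∂(Measure.pi fun _ => μ)
      = ∫ y, ∫ x, G x y ∂μ ∂(Measure.pi fun _ => μ) := by
  have hmp := measurePreserving_piFinSuccAbove (fun _ : Fin (n + 1) => μ) 0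
  have h1 := hmp.integral_comp (MeasurableEquiv.measurableEmbedding _)
    (fun p : E × (Fin n → E) => G p.1 p.2)
  have h2 : ∫ p, G p.1 p.2 ∂(μ.prod (Measure.pi fun _ : Fin n => μ))
      = ∫ y, ∫ x, G x y ∂μ ∂(Measure.pi fun _ => μ) :=
    integral_prod_symm _ (integrable_of_measurable_of_bound hm fun p => hC p.1 p.2)
  rw [← h2, ← h1]
  rfl

variable {μ : Measure E} [IsProbabilityMeasure μ] {g : E → H} {B D A : ℝ}

theorem abs_re_inner_le_of_bound (hB : ∀ x, ‖g x‖ ≤ B) (v : H) (x : E) :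
    |RCLike.re (inner ℂ v (g x))| ≤ ‖v‖ * B :=
  (RCLike.abs_re_le_norm _).trans ((norm_inner_le_norm v (g x)).trans
    (mul_le_mul_of_nonneg_left (hB x) (norm_nonneg v)))

theorem integrable_re_inner (hg : Measurable g) (hB : ∀ x, ‖g x‖ ≤ B) (v : H) :
    Integrable (fun x => RCLike.re (inner ℂ v (g x))) μ :=
  integrable_of_measurable_of_bound
    (RCLike.continuous_re.measurable.comp ((continuous_const.inner continuous_id).measurable.comp hg))
    (abs_re_inner_le_of_bound hB v)

theorem integrable_re_inner_sq (hg : Measurable g) (hB : ∀ x, ‖g x‖ ≤ B) (v : H) :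
    Integrable (fun x => (RCLike.re (inner ℂ v (g x))) ^ 2) μ :=
  integrable_of_measurable_of_bound (C := (‖v‖ * B) ^ 2)
    ((RCLike.continuous_re.measurable.comp
      ((continuous_const.inner continuous_id).measurable.comp hg)).pow_const 2)
    (fun x => by
      rw [abs_pow]
      exact pow_le_pow_left₀ (abs_nonneg _) (abs_re_inner_le_of_bound hB v x) 2)

theorem integral_re_inner [CompleteSpace H] (hg : Measurable g) (hB : ∀ x, ‖g x‖ ≤ B)
    (h0 : ∫ x, g x ∂μ = 0) (v : H) : ∫ x, RCLike.re (inner ℂ v (g x)) ∂μ = 0 := by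
  have hi : Integrable g μ :=
    Integrable.of_bound hg.aestronglyMeasurable B (Filter.Eventually.of_forall hB)
  rw [integral_re (hi.const_inner v), integral_inner hi, h0, inner_zero_right, map_zero]

theorem integral_norm_sq_sum_le [CompleteSpace H] (hg : Measurable g) (hB : ∀ x, ‖g x‖ ≤ B)
    (h0 : ∫ x, g x ∂μ = 0) (hD : ∫ x, ‖g x‖ ^ 2 ∂μ ≤ D) (n : ℕ) :
    ∫ x : Fin n → E, ‖∑ j, g (x j)‖ ^ 2 ∂(Measure.pi fun _ => μ) ≤ n * D := by
  induction n with
  | zero => simp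
  | succ n ih =>
    have hmS := measurable_sum_comp hg n
    have hstep := integral_fin_succ (μ := μ) (n := n)
      (G := fun x y => ‖g x + ∑ j, g (y j)‖ ^ 2) (C := (B + n * B) ^ 2)
      (((hg.comp measurable_fst).add (hmS.comp measurable_snd)).norm.pow_const 2)
      (fun x y => by
        rw [abs_of_nonneg (sq_nonneg _)]
        exact pow_le_pow_left₀ (norm_nonneg _) ((norm_add_le _ _).trans
          (add_le_add (hB x) (norm_sum_le_card_mul hB y))) 2)
    simp only [Fin.sum_univ_succ]
    rw [hstep]
    have hinner : ∀ y : Fin n → E, ∫ x, ‖g x + ∑ j, g (y j)‖ ^ 2 ∂μ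
        = ‖∑ j, g (y j)‖ ^ 2 + ∫ x, ‖g x‖ ^ 2 ∂μ := by
      intro y
      have hi1 : Integrable (fun x => ‖g x‖ ^ 2) μ :=
        integrable_of_measurable_of_bound (C := B ^ 2) (hg.norm.pow_const 2) fun x => by
          rw [abs_of_nonneg (sq_nonneg _)]
          exact pow_le_pow_left₀ (norm_nonneg _) (hB x) 2
      have hi2 := integrable_re_inner (μ := μ) hg hB (∑ j, g (y j))
      simp_rw [add_comm (g _), norm_add_sq (𝕜 := ℂ)]
      have hi4 : Integrable (fun x => ‖∑ j, g (y j)‖ ^ 2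
          + 2 * RCLike.re (inner ℂ (∑ j, g (y j)) (g x))) μ :=
        (integrable_const _).add (hi2.const_mul 2)
      rw [integral_add hi4 hi1,
        integral_add (integrable_const _) (hi2.const_mul 2), integral_const_mul,
        integral_re_inner hg hB h0]
      simp
    simp only [hinner]
    have hi3 : Integrable (fun y : Fin n → E => ‖∑ j, g (y j)‖ ^ 2) (Measure.pi fun _ => μ) :=
      integrable_of_measurable_of_bound (C := (n * B) ^ 2) (hmS.norm.pow_const 2) fun y => by
        rw [abs_of_nonneg (sq_nonneg _)]
        exact pow_le_pow_left₀ (norm_nonneg _) (norm_sum_le_card_mul hB y) 2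
    rw [integral_add hi3 (integrable_const _)]
    simp only [integral_const, probReal_univ, one_smul]
    push_cast
    linarith

/-- The off-diagonal part of `‖∑ g (x j)‖²`. -/
def offDiagNormSq (g : E → H) {n : ℕ} (x : Fin n → E) : ℝ :=
  ‖∑ j, g (x j)‖ ^ 2 - ∑ j, ‖g (x j)‖ ^ 2

theorem measurable_offDiagNormSq (hg : Measurable g) (n : ℕ) :
    Measurable fun x : Fin n → E => offDiagNormSq g x :=
  ((measurable_sum_comp hg n).norm.pow_const 2).sub
    (Finset.measurable_fun_sum _ fun j _ => (hg.comp (measurable_pi_apply j)).norm.pow_const 2)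

theorem abs_offDiagNormSq_le (hB : ∀ x, ‖g x‖ ≤ B) {n : ℕ} (x : Fin n → E) :
    |offDiagNormSq g x| ≤ (n * B) ^ 2 + n * B ^ 2 := by
  have h1 : ‖∑ j, g (x j)‖ ^ 2 ≤ (n * B) ^ 2 :=
    pow_le_pow_left₀ (norm_nonneg _) (norm_sum_le_card_mul hB x) 2
  have h2 : ∑ j, ‖g (x j)‖ ^ 2 ≤ n * B ^ 2 := by
    refine (Finset.sum_le_sum fun j _ => pow_le_pow_left₀ (norm_nonneg _) (hB (x j)) 2).trans ?_
    simp
  have h3 : 0 ≤ ∑ j, ‖g (x j)‖ ^ 2 := Finset.sum_nonneg fun _ _ => sq_nonneg _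
  have h4 := sq_nonneg ‖∑ j, g (x j)‖
  rw [offDiagNormSq, abs_le]
  constructor <;> linarith

theorem integrable_offDiagNormSq_sq (hg : Measurable g) (hB : ∀ x, ‖g x‖ ≤ B) (n : ℕ) :
    Integrable (fun x : Fin n → E => offDiagNormSq g x ^ 2) (Measure.pi fun _ => μ) :=
  integrable_of_measurable_of_bound (C := ((n * B) ^ 2 + n * B ^ 2) ^ 2)
    ((measurable_offDiagNormSq hg n).pow_const 2) fun x => by
      rw [abs_pow]
      exact pow_le_pow_left₀ (abs_nonneg _) (abs_offDiagNormSq_le hB x) 2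

theorem offDiagNormSq_succ {n : ℕ} (x : Fin (n + 1) → E) :
    offDiagNormSq g x = offDiagNormSq g (fun j => x j.succ)
      + 2 * RCLike.re (inner ℂ (∑ j : Fin n, g (x j.succ)) (g (x 0))) := by
  simp only [offDiagNormSq, Fin.sum_univ_succ]
  rw [add_comm (g (x 0)), norm_add_sq (𝕜 := ℂ)]
  ring

/-- Second moment of the off-diagonal part of the squared norm of a centred i.i.d. sum. -/
theorem integral_offDiagNormSq_sq_le [CompleteSpace H] (hg : Measurable g) (hB : ∀ x, ‖g x‖ ≤ B)
    (h0 : ∫ x, g x ∂μ = 0) (hD : ∫ x, ‖g x‖ ^ 2 ∂μ ≤ D) (hD0 : 0 ≤ D) (hA0 : 0 ≤ A)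
    (hA : ∀ v : H, ∫ x, ‖inner ℂ v (g x)‖ ^ 2 ∂μ ≤ A * ‖v‖ ^ 2) (n : ℕ) :
    ∫ x : Fin n → E, offDiagNormSq g x ^ 2 ∂(Measure.pi fun _ => μ) ≤ 2 * (n : ℝ) ^ 2 * D * A := by
  have hB0 : ∀ x : E, 0 ≤ B := fun x => (norm_nonneg _).trans (hB x)
  induction n with
  | zero => simp [offDiagNormSq]
  | succ n ih =>
    have hmS := measurable_sum_comp hg n
    have hmU := measurable_offDiagNormSq hg n
    have hmR : Measurable fun p : E × (Fin n → E) =>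
        RCLike.re (inner ℂ (∑ j, g (p.2 j)) (g p.1)) :=
      RCLike.continuous_re.measurable.comp
        ((hmS.comp measurable_snd).inner (hg.comp measurable_fst))
    have hstep := integral_fin_succ (μ := μ) (n := n)
      (G := fun x y => (offDiagNormSq g y + 2 * RCLike.re (inner ℂ (∑ j, g (y j)) (g x))) ^ 2)
      (C := (((n * B) ^ 2 + n * B ^ 2) + 2 * (n * B * B)) ^ 2)
      (((hmU.comp measurable_snd).add (hmR.const_mul 2)).pow_const 2)
      (fun x y => by
        rw [abs_pow]
        refine pow_le_pow_left₀ (abs_nonneg _) ((abs_add_le _ _).trans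
          (add_le_add (abs_offDiagNormSq_le hB y) ?_)) 2
        rw [abs_mul, abs_two]
        refine mul_le_mul_of_nonneg_left ((abs_re_inner_le_of_bound hB _ x).trans
          (mul_le_mul_of_nonneg_right (norm_sum_le_card_mul hB y) (hB0 x))) two_pos.le)
    simp only [offDiagNormSq_succ]
    rw [hstep]
    have hinner : ∀ y : Fin n → E,
        ∫ x, (offDiagNormSq g y + 2 * RCLike.re (inner ℂ (∑ j, g (y j)) (g x))) ^ 2 ∂μ
          ≤ offDiagNormSq g y ^ 2 + 4 * A * ‖∑ j, g (y j)‖ ^ 2 := by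
      intro y
      have hi1 := integrable_re_inner (μ := μ) hg hB (∑ j, g (y j))
      have hi2 := integrable_re_inner_sq (μ := μ) hg hB (∑ j, g (y j))
      have hexp : ∀ x, (offDiagNormSq g y + 2 * RCLike.re (inner ℂ (∑ j, g (y j)) (g x))) ^ 2
          = offDiagNormSq g y ^ 2 + (4 * offDiagNormSq g y) * RCLike.re (inner ℂ (∑ j, g (y j)) (g x))
            + 4 * RCLike.re (inner ℂ (∑ j, g (y j)) (g x)) ^ 2 := fun x => by ring
      simp only [hexp]
      have hi12 : Integrable (fun x => offDiagNormSq g y ^ 2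
          + (4 * offDiagNormSq g y) * RCLike.re (inner ℂ (∑ j, g (y j)) (g x))) μ :=
        (integrable_const _).add (hi1.const_mul _)
      rw [integral_add hi12 (hi2.const_mul 4),
        integral_add (integrable_const _) (hi1.const_mul _), integral_const_mul,
        integral_re_inner hg hB h0, integral_const_mul]
      simp only [integral_const, probReal_univ, one_smul, mul_zero, add_zero]
      have hle : ∫ x, RCLike.re (inner ℂ (∑ j, g (y j)) (g x)) ^ 2 ∂μ
          ≤ ∫ x, ‖inner ℂ (∑ j, g (y j)) (g x)‖ ^ 2 ∂μ := by
        refine integral_mono hi2 ?_ fun x => ?_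
        · refine integrable_of_measurable_of_bound (C := (‖∑ j, g (y j)‖ * B) ^ 2)
            ((((continuous_const.inner continuous_id).measurable.comp hg)).norm.pow_const 2)
            fun x => ?_
          rw [abs_of_nonneg (sq_nonneg _)]
          exact pow_le_pow_left₀ (norm_nonneg _) ((norm_inner_le_norm _ _).trans
            (mul_le_mul_of_nonneg_left (hB x) (norm_nonneg _))) 2
        · rw [← sq_abs]
          exact pow_le_pow_left₀ (abs_nonneg _) (RCLike.abs_re_le_norm _) 2
      have := hle.trans (hA _)
      linarith
    have hi3 : Integrable (fun y : Fin n → E => ‖∑ j, g (y j)‖ ^ 2) (Measure.pi fun _ => μ) :=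
      integrable_of_measurable_of_bound (C := (n * B) ^ 2) (hmS.norm.pow_const 2) fun y => by
        rw [abs_of_nonneg (sq_nonneg _)]
        exact pow_le_pow_left₀ (norm_nonneg _) (norm_sum_le_card_mul hB y) 2
    have hi4 := integrable_offDiagNormSq_sq (μ := μ) hg hB n
    have hmain : ∫ y : Fin n → E, ∫ x,
        (offDiagNormSq g y + 2 * RCLike.re (inner ℂ (∑ j, g (y j)) (g x))) ^ 2 ∂μ
          ∂(Measure.pi fun _ => μ)
        ≤ ∫ y : Fin n → E, (offDiagNormSq g y ^ 2 + 4 * A * ‖∑ j, g (y j)‖ ^ 2)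
          ∂(Measure.pi fun _ => μ) :=
      integral_mono_of_nonneg
        (Filter.Eventually.of_forall fun y => integral_nonneg fun x => sq_nonneg _)
        (hi4.add (hi3.const_mul _)) (Filter.Eventually.of_forall hinner)
    refine hmain.trans ?_
    rw [integral_add hi4 (hi3.const_mul _), integral_const_mul]
    have h1 := integral_norm_sq_sum_le hg hB h0 hD n
    have h2 := mul_le_mul_of_nonneg_left h1 (by positivity : 0 ≤ 4 * A)
    push_cast
    have hDA : 0 ≤ D * A := mul_nonneg hD0 hA0
    nlinarith

end DegenerateSum

section Sample

variable {d : ℕ} {f : (Fin d → ℝ) → ℝ}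

theorem integral_densMeasure {E : Type*} [NormedAddCommGroup E] [NormedSpace ℝ E]
    (hf : IsDensity d f) (h : (Fin d → ℝ) → E) :
    ∫ x, h x ∂densMeasure d f = ∫ x in cube d, f x • h x := by
  rw [densMeasure, integral_withDensity_eq_integral_toReal_smul hf.1.ennreal_ofReal
    (Filter.Eventually.of_forall fun _ => ENNReal.ofReal_lt_top)]
  refine setIntegral_congr_fun (measurableSet_cube d) fun x hx => ?_
  simp only [ENNReal.toReal_ofReal (hf.2.1 x hx)]

theorem isProbabilityMeasure_densMeasure (hf : IsDensity d f) :
    IsProbabilityMeasure (densMeasure d f) := by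
  have hi : Integrable f (volume.restrict (cube d)) := by
    by_contra h
    have := hf.2.2
    rw [integral_undef h] at this
    exact zero_ne_one this
  constructor
  rw [densMeasure, withDensity_apply _ MeasurableSet.univ, Measure.restrict_univ,
    ← ofReal_integral_eq_lintegral_ofReal hi, hf.2.2, ENNReal.ofReal_one]
  filter_upwards [ae_restrict_mem (measurableSet_cube d)] with x hx using hf.2.1 x hx

theorem fCoeff_eq_integral_densMeasure (hf : IsDensity d f) (k : Fin d → ℤ) :
    fCoeff d (fun x => (f x : ℂ)) k = ∫ x, (starRingEnd ℂ) (phi d k x) ∂densMeasure d f := by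
  rw [integral_densMeasure hf, fCoeff]
  simp only [Complex.real_smul]

theorem integral_densMeasure_le (hf : IsDensity d f)
    (hb : eLpNorm (fun x => f x) ⊤ (volume.restrict (cube d)) < ⊤)
    {h : (Fin d → ℝ) → ℝ} (hh : Continuous h) (h0 : ∀ x, 0 ≤ h x) :
    ∫ x, h x ∂densMeasure d f ≤ supNorm d f * ∫ x in cube d, h x := by
  have hA : ∀ᵐ x ∂(volume.restrict (cube d)), ‖f x‖ ≤ supNorm d f := by
    filter_upwards [ae_le_eLpNormEssSup (f := f) (μ := volume.restrict (cube d))] with x hx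
    rw [← eLpNorm_exponent_top] at hx
    have := ENNReal.toReal_mono hb.ne hx
    simpa [supNorm] using this
  have hi : Integrable h (volume.restrict (cube d)) :=
    hh.continuousOn.integrableOn_compact (isCompact_cube d)
  rw [integral_densMeasure hf, ← integral_const_mul]
  refine integral_mono_ae (hi.bdd_mul hf.1.aestronglyMeasurable hA) (hi.const_mul _) ?_
  filter_upwards [hA] with x hx
  exact mul_le_mul_of_nonneg_right ((le_abs_self _).trans hx) (h0 x)

/-- The vector of centred Fourier features with frequencies in the box. -/
def centredFeature (d : ℕ) (f : (Fin d → ℝ) → ℝ) (M : ℕ) (x : Fin d → ℝ) :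
    EuclideanSpace ℂ (Fin d → Fin (2 * M + 1)) :=
  WithLp.toLp 2 fun ν => (starRingEnd ℂ) (phi d (toIdx d M ν) x)
    - fCoeff d (fun x => (f x : ℂ)) (toIdx d M ν)

theorem continuous_centredFeature (d : ℕ) (f : (Fin d → ℝ) → ℝ) (M : ℕ) :
    Continuous (centredFeature d f M) := by
  refine (PiLp.continuous_toLp 2 _).comp (continuous_pi fun ν => ?_)
  exact (Complex.continuous_conj.comp (continuous_phi d _)).sub continuous_const

theorem norm_fCoeff_le_one (hf : IsDensity d f) (k : Fin d → ℤ) :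
    ‖fCoeff d (fun x => (f x : ℂ)) k‖ ≤ 1 := by
  have := isProbabilityMeasure_densMeasure hf
  rw [fCoeff_eq_integral_densMeasure hf]
  refine (norm_integral_le_of_norm_le_const (C := 1)
    (Filter.Eventually.of_forall fun x => ?_)).trans ?_
  · simp [norm_phi]
  · simp

theorem norm_sq_centredFeature_le (hf : IsDensity d f) (M : ℕ) (x : Fin d → ℝ) :
    ‖centredFeature d f M x‖ ^ 2 ≤ 4 * ((2 * M + 1 : ℕ) : ℝ) ^ d := by
  rw [EuclideanSpace.norm_sq_eq]
  have : ∀ ν, ‖(centredFeature d f M x) ν‖ ^ 2 ≤ 4 := fun ν => by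
    have h : ‖(centredFeature d f M x) ν‖ ≤ 2 := by
      refine (norm_sub_le _ _).trans ?_
      rw [RCLike.norm_conj, norm_phi]
      linarith [norm_fCoeff_le_one hf (toIdx d M ν)]
    nlinarith [norm_nonneg ((centredFeature d f M x) ν)]
  refine (Finset.sum_le_sum fun ν _ => this ν).trans (le_of_eq ?_)
  simp [mul_comm]

theorem norm_centredFeature_le (hf : IsDensity d f) (M : ℕ) (x : Fin d → ℝ) :
    ‖centredFeature d f M x‖ ≤ Real.sqrt (4 * ((2 * M + 1 : ℕ) : ℝ) ^ d) :=
  Real.le_sqrt_of_sq_le (norm_sq_centredFeature_le hf M x)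

theorem integral_centredFeature (hf : IsDensity d f) (M : ℕ) :
    ∫ x, centredFeature d f M x ∂densMeasure d f = 0 := by
  have := isProbabilityMeasure_densMeasure hf
  have hi : Integrable (centredFeature d f M) (densMeasure d f) :=
    Integrable.of_bound (continuous_centredFeature d f M).aestronglyMeasurable _
      (Filter.Eventually.of_forall (norm_centredFeature_le hf M))
  ext ν
  have h := (EuclideanSpace.proj (𝕜 := ℂ) ν).integral_comp_comm hi
  refine h.symm.trans ?_
  simp only [PiLp.proj_apply, centredFeature, PiLp.zero_apply]
  have hi' : Integrable (fun x => (starRingEnd ℂ) (phi d (toIdx d M ν) x)) (densMeasure d f) :=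
    Integrable.of_bound
      (Complex.continuous_conj.comp (continuous_phi d _)).aestronglyMeasurable 1
      (Filter.Eventually.of_forall fun x => by simp [norm_phi])
  rw [integral_sub hi' (integrable_const _), ← fCoeff_eq_integral_densMeasure hf]
  simp

theorem inner_centredFeature (M : ℕ) (v : EuclideanSpace ℂ (Fin d → Fin (2 * M + 1))) :
    ∃ c : ℂ, ∀ x, inner ℂ v (centredFeature d f M x)
      = (starRingEnd ℂ) (trigPoly d (box d M) (fun k => v (unIdx d M k)) x) - c := by
  refine ⟨∑ ν, fCoeff d (fun x => (f x : ℂ)) (toIdx d M ν) * (starRingEnd ℂ) (v ν), fun x => ?_⟩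
  rw [trigPoly, ← sum_toIdx fun k ν => v ν * phi d k x, map_sum, ← Finset.sum_sub_distrib,
    PiLp.inner_apply]
  refine Finset.sum_congr rfl fun ν _ => ?_
  rw [RCLike.inner_apply, map_mul, centredFeature]
  ring

theorem integral_norm_inner_centredFeature_sq_le (hf : IsDensity d f)
    (hb : eLpNorm (fun x => f x) ⊤ (volume.restrict (cube d)) < ⊤) (M : ℕ)
    (v : EuclideanSpace ℂ (Fin d → Fin (2 * M + 1))) :
    ∫ x, ‖inner ℂ v (centredFeature d f M x)‖ ^ 2 ∂densMeasure d f
      ≤ supNorm d f * ‖v‖ ^ 2 := by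
  have := isProbabilityMeasure_densMeasure hf
  obtain ⟨c, hc⟩ := inner_centredFeature (f := f) M v
  set T := trigPoly d (box d M) (fun k => v (unIdx d M k))
  set h : (Fin d → ℝ) → ℂ := fun x => inner ℂ v (centredFeature d f M x) with hh
  have hcont : Continuous h := continuous_const.inner (continuous_centredFeature d f M)
  have hB : ∀ x, ‖h x‖ ≤ ‖v‖ * Real.sqrt (4 * ((2 * M + 1 : ℕ) : ℝ) ^ d) := fun x =>
    (norm_inner_le_norm _ _).trans
      (mul_le_mul_of_nonneg_left (norm_centredFeature_le hf M x) (norm_nonneg _))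
  have h0 : ∫ x, h x ∂densMeasure d f = 0 := by
    rw [hh, integral_inner, integral_centredFeature hf, inner_zero_right]
    exact Integrable.of_bound (continuous_centredFeature d f M).aestronglyMeasurable _
      (Filter.Eventually.of_forall (norm_centredFeature_le hf M))
  have hre := integral_re_inner (μ := densMeasure d f) hcont.measurable hB h0 c
  have hire := integrable_re_inner (μ := densMeasure d f) hcont.measurable hB c
  have hisq : Integrable (fun x => ‖h x‖ ^ 2) (densMeasure d f) :=
    integrable_of_measurable_of_bound
      (C := (‖v‖ * Real.sqrt (4 * ((2 * M + 1 : ℕ) : ℝ) ^ d)) ^ 2)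
      (hcont.norm.pow 2).measurable fun x => by
        rw [abs_of_nonneg (sq_nonneg _)]
        exact pow_le_pow_left₀ (norm_nonneg _) (hB x) 2
  have hTh : ∀ x, ‖T x‖ ^ 2 = ‖h x‖ ^ 2 + 2 * RCLike.re (inner ℂ c (h x)) + ‖c‖ ^ 2 := fun x => by
    have h1 : (starRingEnd ℂ) (T x) = c + h x := by rw [hh]; simp only [hc]; ring
    rw [← RCLike.norm_conj, h1, norm_add_sq (𝕜 := ℂ)]
    ring
  have hi12 : Integrable (fun x => ‖h x‖ ^ 2 + 2 * RCLike.re (inner ℂ c (h x)))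
    (densMeasure d f) := hisq.add (hire.const_mul 2)
  have h_cube_int : ∫ x, ‖T x‖ ^ 2 ∂densMeasure d f = ∫ x, ‖h x‖ ^ 2 ∂densMeasure d f + ‖c‖ ^ 2 := by
    simp only [hTh]
    rw [integral_add hi12 (integrable_const _), integral_add hisq (hire.const_mul 2),
      integral_const_mul, hre]
    simp
  have hle := integral_densMeasure_le hf hb (h := fun x => ‖T x‖ ^ 2)
    (((continuous_trigPoly d (box d M) (fun k => v (unIdx d M k))).norm.pow 2))
    (fun x => sq_nonneg _)
  have hl2 : ∫ x in cube d, ‖T x‖ ^ 2 = ‖v‖ ^ 2 := by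
    have := l2sq_trigPoly d (box d M) (fun k => v (unIdx d M k))
    rw [← sum_toIdx fun k ν => ‖v ν‖ ^ 2, ← EuclideanSpace.norm_sq_eq] at this
    exact this
  rw [hl2, h_cube_int] at hle
  linarith [sq_nonneg ‖c‖]

theorem supNorm_nonneg (d : ℕ) (f : (Fin d → ℝ) → ℝ) : 0 ≤ supNorm d f := ENNReal.toReal_nonneg

/-- The stochastic excess of the empirical coefficients over the penalty. -/
def sampleExcess (d n M : ℕ) (f : (Fin d → ℝ) → ℝ) (X : Fin n → (Fin d → ℝ)) : ℝ :=
  offDiagNormSq (centredFeature d f M) X ^ 2 / (20 * ((2 * M + 1 : ℕ) : ℝ) ^ d * (n : ℝ) ^ 3)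

theorem sampleExcess_nonneg (d n M : ℕ) (f : (Fin d → ℝ) → ℝ) (X : Fin n → (Fin d → ℝ)) :
    0 ≤ sampleExcess d n M f X := by unfold sampleExcess; positivity

theorem integrable_sampleExcess (hf : IsDensity d f) (n M : ℕ) :
    Integrable (sampleExcess d n M f) (Measure.pi fun _ => densMeasure d f) := by
  have := isProbabilityMeasure_densMeasure hf
  exact (integrable_offDiagNormSq_sq (continuous_centredFeature d f M).measurable
    (norm_centredFeature_le hf M) n).div_const _

theorem integral_sampleExcess_le (hf : IsDensity d f)
    (hb : eLpNorm (fun x => f x) ⊤ (volume.restrict (cube d)) < ⊤) {n : ℕ} (hn : 1 ≤ n) (M : ℕ) :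
    ∫ X, sampleExcess d n M f X ∂(Measure.pi fun _ => densMeasure d f)
      ≤ 2 * supNorm d f / (5 * n) := by
  have := isProbabilityMeasure_densMeasure hf
  have hn' : (0 : ℝ) < n := by exact_mod_cast hn
  have hD : (0 : ℝ) < ((2 * M + 1 : ℕ) : ℝ) ^ d := by positivity
  have hD4 : ∫ x, ‖centredFeature d f M x‖ ^ 2 ∂densMeasure d f
      ≤ 4 * ((2 * M + 1 : ℕ) : ℝ) ^ d := by
    refine (integral_mono_of_nonneg (Filter.Eventually.of_forall fun _ => sq_nonneg _)
      (integrable_const _)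
      (Filter.Eventually.of_forall (norm_sq_centredFeature_le hf M))).trans ?_
    simp
  have h := integral_offDiagNormSq_sq_le (continuous_centredFeature d f M).measurable
    (norm_centredFeature_le hf M) (integral_centredFeature hf M) hD4 (by positivity)
    (supNorm_nonneg d f) (integral_norm_inner_centredFeature_sq_le hf hb M) n
  unfold sampleExcess
  rw [integral_div, div_le_div_iff₀ (by positivity) (by positivity)]
  refine (mul_le_mul_of_nonneg_right h (by positivity)).trans (le_of_eq ?_)
  ring

theorem sum_norm_fCoeff_sub_empCoeff_sq_le (hf : IsDensity d f) {n : ℕ} (hn : 1 ≤ n) (M : ℕ)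
    (X : Fin n → (Fin d → ℝ)) :
    4 * ∑ ν, ‖fCoeff d (fun x => (f x : ℂ)) (toIdx d M ν) - empCoeff d n X (toIdx d M ν)‖ ^ 2
      ≤ 96 * ((2 * M + 1 : ℕ) : ℝ) ^ d / n + sampleExcess d n M f X := by
  have hn' : (0 : ℝ) < n := by exact_mod_cast hn
  have hD : (0 : ℝ) < ((2 * M + 1 : ℕ) : ℝ) ^ d := by positivity
  have h1 : ∑ ν, ‖fCoeff d (fun x => (f x : ℂ)) (toIdx d M ν)
      - empCoeff d n X (toIdx d M ν)‖ ^ 2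
      = ‖∑ j, centredFeature d f M (X j)‖ ^ 2 / (n : ℝ) ^ 2 := by
    rw [EuclideanSpace.norm_sq_eq, Finset.sum_div]
    refine Finset.sum_congr rfl fun ν _ => ?_
    have : (∑ j, centredFeature d f M (X j)) ν
        = -(n : ℂ) * (fCoeff d (fun x => (f x : ℂ)) (toIdx d M ν)
          - empCoeff d n X (toIdx d M ν)) := by
      have hnC : (n : ℂ) ≠ 0 := by exact_mod_cast hn'.ne'
      simp only [WithLp.ofLp_sum, Finset.sum_apply, centredFeature, empCoeff,
        Finset.sum_sub_distrib, Finset.sum_const, Finset.card_univ, Fintype.card_fin, nsmul_eq_mul]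
      field_simp
      ring
    rw [this, norm_mul, mul_pow, norm_neg, Complex.norm_natCast]
    field_simp
  have h2 : ∑ j, ‖centredFeature d f M (X j)‖ ^ 2 ≤ n * (4 * ((2 * M + 1 : ℕ) : ℝ) ^ d) := by
    refine (Finset.sum_le_sum fun j _ => norm_sq_centredFeature_le hf M (X j)).trans ?_
    simp
  rw [h1]
  have h3 : ‖∑ j, centredFeature d f M (X j)‖ ^ 2
      = offDiagNormSq (centredFeature d f M) X + ∑ j, ‖centredFeature d f M (X j)‖ ^ 2 := by
    rw [offDiagNormSq]; ring
  rw [h3, sampleExcess]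
  set U := offDiagNormSq (centredFeature d f M) X
  set D := ((2 * M + 1 : ℕ) : ℝ) ^ d
  have h4 : 4 * ((U + n * (4 * D)) / (n : ℝ) ^ 2) ≤ 96 * D / n + U ^ 2 / (20 * D * (n : ℝ) ^ 3) := by
    have : 96 * D / n + U ^ 2 / (20 * D * (n : ℝ) ^ 3) - 4 * ((U + n * (4 * D)) / (n : ℝ) ^ 2)
        = (U - 40 * D * n) ^ 2 / (20 * D * (n : ℝ) ^ 3) := by
      field_simp
      ring
    have h5 : 0 ≤ (U - 40 * D * n) ^ 2 / (20 * D * (n : ℝ) ^ 3) := by positivity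
    linarith
  refine le_trans ?_ h4
  gcongr

end Sample

section Noise

instance isProbabilityMeasure_stdCGauss : IsProbabilityMeasure stdCGauss := by
  unfold stdCGauss
  exact Measure.isProbabilityMeasure_map (by fun_prop)

theorem integral_exp_sq_div_four_gaussianReal :
    ∫ x, Real.exp (x ^ 2 / 4) ∂gaussianReal 0 1 = Real.sqrt 2 := by
  rw [integral_gaussianReal_eq_integral_smul one_ne_zero]
  have h : ∀ x : ℝ, gaussianPDFReal 0 1 x • Real.exp (x ^ 2 / 4)
      = (Real.sqrt (2 * Real.pi))⁻¹ * Real.exp (-(1 / 4) * x ^ 2) := fun x => by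
    simp only [gaussianPDFReal, smul_eq_mul, NNReal.coe_one, mul_one, sub_zero]
    rw [mul_assoc, ← Real.exp_add]
    congr 2
    ring
  simp only [h]
  rw [integral_const_mul, integral_gaussian, ← Real.sqrt_inv, ← Real.sqrt_mul (by positivity)]
  congr 1
  have := Real.pi_ne_zero
  field_simp
  norm_num

theorem integral_exp_norm_sq_div_four_stdCGauss :
    ∫ z, Real.exp (‖z‖ ^ 2 / 4) ∂stdCGauss = 2 := by
  rw [stdCGauss, integral_map (by fun_prop)
    (by exact (by fun_prop : Continuous fun z : ℂ => Real.exp (‖z‖ ^ 2 / 4)).aestronglyMeasurable)]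
  have h : ∀ p : ℝ × ℝ, Real.exp (‖(p.1 : ℂ) + (p.2 : ℂ) * Complex.I‖ ^ 2 / 4)
      = Real.exp (p.1 ^ 2 / 4) * Real.exp (p.2 ^ 2 / 4) := fun p => by
    rw [← Real.exp_add, Complex.sq_norm, Complex.normSq_add_mul_I, add_div]
  simp only [h]
  rw [integral_prod_mul (fun x : ℝ => Real.exp (x ^ 2 / 4)) (fun x : ℝ => Real.exp (x ^ 2 / 4)),
    integral_exp_sq_div_four_gaussianReal]
  exact Real.mul_self_sqrt (by norm_num)

theorem integral_exp_sum_norm_sq_stdCGauss (ι : Type*) [Fintype ι] :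
    ∫ ξ : ι → ℂ, Real.exp ((∑ i, ‖ξ i‖ ^ 2) / 4) ∂(Measure.pi fun _ => stdCGauss)
      = 2 ^ Fintype.card ι := by
  rw [← integral_exp_norm_sq_div_four_stdCGauss, ← integral_fintype_prod_eq_pow]
  simp only [Finset.sum_div, Real.exp_sum]

/-- The stochastic excess of the Gaussian noise over the penalty. -/
def noiseExcess (d M : ℕ) (σ : ℝ) (ξ : (Fin d → Fin (2 * M + 1)) → ℂ) : ℝ :=
  16 * σ ^ 2 * Real.exp ((∑ ν, ‖ξ ν‖ ^ 2) / 4 - 3 / 2 * ((2 * M + 1 : ℕ) : ℝ) ^ d)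

variable {d M : ℕ} {σ : ℝ}

theorem noiseExcess_nonneg (ξ : (Fin d → Fin (2 * M + 1)) → ℂ) : 0 ≤ noiseExcess d M σ ξ := by
  unfold noiseExcess; positivity

theorem noiseExcess_eq (ξ : (Fin d → Fin (2 * M + 1)) → ℂ) :
    noiseExcess d M σ ξ = 16 * σ ^ 2 * Real.exp (-(3 / 2 * ((2 * M + 1 : ℕ) : ℝ) ^ d))
      * Real.exp ((∑ ν, ‖ξ ν‖ ^ 2) / 4) := by
  rw [noiseExcess, sub_eq_add_neg, Real.exp_add]
  ring

theorem integrable_noiseExcess :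
    Integrable (noiseExcess d M σ) (Measure.pi fun _ => stdCGauss) := by
  have h : Integrable (fun ξ : (Fin d → Fin (2 * M + 1)) → ℂ =>
      Real.exp ((∑ ν, ‖ξ ν‖ ^ 2) / 4)) (Measure.pi fun _ => stdCGauss) := by
    by_contra h
    have h2 := integral_exp_sum_norm_sq_stdCGauss (Fin d → Fin (2 * M + 1))
    rw [integral_undef h] at h2
    exact (pow_ne_zero _ (two_ne_zero' ℝ)) h2.symm
  rw [funext noiseExcess_eq]
  exact h.const_mul _

theorem integral_noiseExcess_le :
    ∫ ξ, noiseExcess d M σ ξ ∂(Measure.pi fun _ => stdCGauss)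
      ≤ 16 * σ ^ 2 * (1 / 2) ^ ((2 * M + 1) ^ d) := by
  simp only [noiseExcess_eq]
  rw [integral_const_mul, integral_exp_sum_norm_sq_stdCGauss, mul_assoc]
  refine mul_le_mul_of_nonneg_left ?_ (by positivity)
  have hcard : Fintype.card (Fin d → Fin (2 * M + 1)) = (2 * M + 1) ^ d := by simp
  have he : Real.exp (-(3 / 2)) ≤ 1 / 4 := by
    rw [Real.exp_neg, inv_eq_one_div]
    refine one_div_le_one_div_of_le (by norm_num) ?_
    have h1 : Real.exp (3 / 2) = Real.exp (1 / 2) * Real.exp (1 / 2) * Real.exp (1 / 2) := by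
      rw [← Real.exp_add, ← Real.exp_add]; norm_num
    have h2 := Real.quadratic_le_exp_of_nonneg (by norm_num : (0 : ℝ) ≤ 1 / 2)
    have h3 : (1.6 : ℝ) ≤ Real.exp (1 / 2) := by norm_num at h2 ⊢; linarith
    rw [h1]
    nlinarith [mul_le_mul h3 h3 (by norm_num) (Real.exp_pos _).le]
  have he2 : Real.exp (-(3 / 2 * ((2 * M + 1 : ℕ) : ℝ) ^ d))
      = Real.exp (-(3 / 2)) ^ ((2 * M + 1) ^ d) := by
    rw [← Real.exp_nat_mul]
    congr 1
    push_cast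
    ring
  rw [hcard, he2, ← mul_pow]
  exact pow_le_pow_left₀ (by positivity) (by linarith) _

theorem mul_sum_norm_sq_le_noiseExcess (ξ : (Fin d → Fin (2 * M + 1)) → ℂ) :
    4 * (σ ^ 2 * ∑ ν, ‖ξ ν‖ ^ 2)
      ≤ 24 * ((2 * M + 1 : ℕ) : ℝ) ^ d * σ ^ 2 + noiseExcess d M σ ξ := by
  set S := ∑ ν, ‖ξ ν‖ ^ 2
  set D := ((2 * M + 1 : ℕ) : ℝ) ^ d
  have h := Real.add_one_le_exp (S / 4 - 3 / 2 * D)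
  have h2 := mul_le_mul_of_nonneg_left h (by positivity : 0 ≤ 16 * σ ^ 2)
  have h3 : noiseExcess d M σ ξ = 16 * σ ^ 2 * Real.exp (S / 4 - 3 / 2 * D) := rfl
  rw [h3]
  nlinarith [sq_nonneg σ]

end Noise

section Excess

variable {d n : ℕ} {𝓜 : Finset ℕ} {ρ : ℝ} {f : (Fin d → ℝ) → ℝ}

theorem sigmaSel_sq (d n : ℕ) (𝓜 : Finset ℕ) (hρ : 0 < ρ) (M : ℕ) :
    sigmaSel d n 𝓜 ρ M ^ 2
      = 4 * ((2 * M + 1 : ℕ) : ℝ) ^ d / ((n : ℝ) ^ 2 * (ρ / 𝓜.card)) := by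
  rw [sigmaSel, div_pow, mul_pow, mul_pow, Real.sq_sqrt (by positivity),
    Real.sq_sqrt (by positivity)]
  norm_num

/-- Total stochastic excess at cut-off `M`. -/
def excess (f : (Fin d → ℝ) → ℝ) (ρ : ℝ) (ω : SelSpace d n 𝓜) (M : ℕ) : ℝ :=
  sampleExcess d n M f ω.1
    + if h : M ∈ 𝓜 then noiseExcess d M (sigmaSel d n 𝓜 ρ M) (ω.2 ⟨M, h⟩) else 0

theorem excess_nonneg (f : (Fin d → ℝ) → ℝ) (ρ : ℝ) (ω : SelSpace d n 𝓜) (M : ℕ) :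
    0 ≤ excess f ρ ω M := by
  refine add_nonneg (sampleExcess_nonneg _ _ _ _ _) ?_
  split_ifs with h
  · exact noiseExcess_nonneg _
  · exact le_rfl

theorem two_mul_l2sq_projM_sub_selEstN_le (hf : IsDensity d f) (hn : 1 ≤ n) (hρ : 0 < ρ)
    (ω : SelSpace d n 𝓜) {M : ℕ} (hM : M ∈ 𝓜) :
    2 * l2sq d (fun x => projM d M (fun y => (f y : ℂ)) x - selEstN d n 𝓜 ρ M ω x)
      ≤ lam1 d n 𝓜 ρ M + excess f ρ ω M := by
  rw [l2sq_projM_sub_selEstN ρ hM, excess, dif_pos hM, lam1]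
  have h1 := sum_norm_fCoeff_sub_empCoeff_sq_le hf hn M ω.1
  have h2 := mul_sum_norm_sq_le_noiseExcess (σ := sigmaSel d n 𝓜 ρ M) (ω.2 ⟨M, hM⟩)
  have h3 : 24 * ((2 * M + 1 : ℕ) : ℝ) ^ d * sigmaSel d n 𝓜 ρ M ^ 2
      = 96 * ((2 * M + 1 : ℕ) : ℝ) ^ (2 * d) / ((n : ℝ) ^ 2 * (ρ / 𝓜.card)) := by
    rw [sigmaSel_sq d n 𝓜 hρ]
    ring
  have h4 : ∑ ν, ‖fCoeff d (fun y => (f y : ℂ)) (toIdx d M ν) - (empCoeff d n ω.1 (toIdx d M ν)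
        + (sigmaSel d n 𝓜 ρ M : ℂ) * ω.2 ⟨M, hM⟩ ν)‖ ^ 2
      ≤ 2 * ∑ ν, ‖fCoeff d (fun y => (f y : ℂ)) (toIdx d M ν) - empCoeff d n ω.1 (toIdx d M ν)‖ ^ 2
        + 2 * (sigmaSel d n 𝓜 ρ M ^ 2 * ∑ ν, ‖ω.2 ⟨M, hM⟩ ν‖ ^ 2) := by
    rw [Finset.mul_sum, Finset.mul_sum, Finset.mul_sum, ← Finset.sum_add_distrib]
    refine Finset.sum_le_sum fun ν _ => ?_
    rw [← sub_sub]
    set a := fCoeff d (fun y => (f y : ℂ)) (toIdx d M ν) - empCoeff d n ω.1 (toIdx d M ν)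
    have h5 := norm_sub_le a ((sigmaSel d n 𝓜 ρ M : ℂ) * ω.2 ⟨M, hM⟩ ν)
    have h6 : ‖(sigmaSel d n 𝓜 ρ M : ℂ) * ω.2 ⟨M, hM⟩ ν‖ ^ 2
        = sigmaSel d n 𝓜 ρ M ^ 2 * ‖ω.2 ⟨M, hM⟩ ν‖ ^ 2 := by
      rw [norm_mul, mul_pow, Complex.norm_real, Real.norm_eq_abs, sq_abs]
    rw [← h6]
    set b := (sigmaSel d n 𝓜 ρ M : ℂ) * ω.2 ⟨M, hM⟩ ν
    nlinarith [pow_le_pow_left₀ (norm_nonneg _) h5 2, sq_nonneg (‖a‖ - ‖b‖)]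
  linarith

theorem integrable_excess (hf : IsDensity d f) (ρ : ℝ) (M : ℕ) :
    Integrable (fun ω : SelSpace d n 𝓜 => excess f ρ ω M) (selMeasure d n 𝓜 f) := by
  have := isProbabilityMeasure_densMeasure hf
  unfold excess selMeasure
  refine ((integrable_sampleExcess hf n M).comp_fst _).add ?_
  split_ifs with h
  · exact Integrable.comp_snd (f := fun ξ : (M : 𝓜) → (Fin d → Fin (2 * (M : ℕ) + 1)) → ℂ =>
      noiseExcess d M (sigmaSel d n 𝓜 ρ M) (ξ ⟨M, h⟩))
      (integrable_comp_eval (i := (⟨M, h⟩ : 𝓜)) integrable_noiseExcess) _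
  · exact integrable_zero _ _ _

theorem integral_excess_le (hf : IsDensity d f)
    (hb : eLpNorm (fun x => f x) ⊤ (volume.restrict (cube d)) < ⊤) (hn : 1 ≤ n) {M : ℕ}
    (hM : M ∈ 𝓜) :
    ∫ ω : SelSpace d n 𝓜, excess f ρ ω M ∂selMeasure d n 𝓜 f
      ≤ 2 * supNorm d f / (5 * n)
        + 16 * sigmaSel d n 𝓜 ρ M ^ 2 * (1 / 2) ^ ((2 * M + 1) ^ d) := by
  have := isProbabilityMeasure_densMeasure hf
  have hi : Integrable (fun ξ : (M : 𝓜) → (Fin d → Fin (2 * (M : ℕ) + 1)) → ℂ =>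
      noiseExcess d M (sigmaSel d n 𝓜 ρ M) (ξ ⟨M, hM⟩))
      (Measure.pi fun _ => Measure.pi fun _ => stdCGauss) :=
    integrable_comp_eval (i := (⟨M, hM⟩ : 𝓜)) integrable_noiseExcess
  unfold excess selMeasure
  simp only [dif_pos hM]
  rw [integral_add ((integrable_sampleExcess hf n M).comp_fst _) (hi.comp_snd _),
    integral_fun_fst (fun X => sampleExcess d n M f X),
    integral_fun_snd (fun ξ : (M : 𝓜) → (Fin d → Fin (2 * (M : ℕ) + 1)) → ℂ =>
      noiseExcess d M (sigmaSel d n 𝓜 ρ M) (ξ ⟨M, hM⟩)),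
    integral_comp_eval (i := (⟨M, hM⟩ : 𝓜)) integrable_noiseExcess.aestronglyMeasurable]
  simp only [probReal_univ, one_smul]
  exact add_le_add (integral_sampleExcess_le hf hb hn M) integral_noiseExcess_le

end Excess

section Dyadic

theorem one_mem_dyadic (d n : ℕ) : 1 ∈ dyadic d n :=
  Finset.mem_image.2 ⟨0, Finset.mem_range.2 (Nat.succ_pos _), pow_zero 2⟩

theorem one_le_of_mem_dyadic {d n M : ℕ} (h : M ∈ dyadic d n) : 1 ≤ M := by
  obtain ⟨j, -, rfl⟩ := Finset.mem_image.1 h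
  exact Nat.one_le_two_pow

theorem card_dyadic_le {d n : ℕ} (hd : 1 ≤ d) (hn : 3 ≤ (n : ℝ) ^ ((1 : ℝ) / d)) :
    ((dyadic d n).card : ℝ) ≤ Real.logb 2 n := by
  have hd' : (1 : ℝ) ≤ d := by exact_mod_cast hd
  have hn1 : 1 ≤ (n : ℝ) := by
    by_contra! h
    have := Real.rpow_le_one n.cast_nonneg h.le (by positivity : 0 ≤ (1 : ℝ) / d)
    linarith
  set y := (n : ℝ) ^ ((1 : ℝ) / d) with hy
  have hcard : (dyadic d n).card ≤ ⌊Real.logb 2 ((y - 1) / 2)⌋₊ + 1 :=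
    Finset.card_image_le.trans (by simp [hy])
  have hcard' : ((dyadic d n).card : ℝ) ≤ ⌊Real.logb 2 ((y - 1) / 2)⌋₊ + 1 := by
    exact_mod_cast hcard
  have h0 : 0 ≤ Real.logb 2 ((y - 1) / 2) := Real.logb_nonneg (by norm_num) (by linarith)
  have h1 := Nat.floor_le h0
  have h2 : Real.logb 2 ((y - 1) / 2) ≤ Real.logb 2 (n / 2) := by
    refine Real.logb_le_logb_of_le (by norm_num) (by linarith) ?_
    have : y ≤ n := by
      rw [hy]
      conv_rhs => rw [← Real.rpow_one (n : ℝ)]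
      exact Real.rpow_le_rpow_of_exponent_le hn1 (by rw [div_le_one (by linarith)]; exact hd')
    linarith
  have h3 : Real.logb 2 ((n : ℝ) / 2) = Real.logb 2 n - 1 := by
    rw [Real.logb_div (by linarith) (by norm_num), Real.logb_self_eq_one (by norm_num)]
  linarith

theorem exists_mem_dyadic {d n : ℕ} {x : ℝ} (hx1 : 1 ≤ x)
    (hx : x ≤ ((n : ℝ) ^ ((1 : ℝ) / d) - 1) / 2) : ∃ M ∈ dyadic d n, (M : ℝ) ≤ x ∧ x ≤ 2 * M := by
  obtain ⟨j, hj1, hj2⟩ := exists_nat_pow_near hx1 (by norm_num : (1 : ℝ) < 2)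
  refine ⟨2 ^ j, Finset.mem_image.2 ⟨j, Finset.mem_range.2 (Nat.lt_succ_of_le ?_), rfl⟩, ?_, ?_⟩
  · refine Nat.le_floor ?_
    rw [Real.le_logb_iff_rpow_le (by norm_num) (by linarith), Real.rpow_natCast]
    exact hj1.trans hx
  · exact_mod_cast hj1
  · push_cast
    rw [pow_succ] at hj2
    linarith

theorem mul_self_le_two_mul_two_pow (D : ℕ) : D * D ≤ 2 * 2 ^ D := by
  by_cases h : D < 3
  · interval_cases D <;> norm_num
  · push Not at h
    induction D, h using Nat.le_induction with
    | base => norm_num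
    | succ D hD ih => rw [pow_succ]; nlinarith

theorem pow_mul_half_pow_le {d M : ℕ} (hd : 1 ≤ d) (hM : 1 ≤ M) :
    ((2 * M + 1 : ℕ) : ℝ) ^ d * (1 / 2) ^ ((2 * M + 1) ^ d) ≤ (M : ℝ)⁻¹ := by
  set D := (2 * M + 1) ^ d with hDdef
  have hMD : 2 * M ≤ D := (Nat.le_succ _).trans (Nat.le_self_pow (by omega) _)
  have h1 : M * D ≤ 2 ^ D := by
    have := mul_self_le_two_mul_two_pow D
    nlinarith
  have hM' : (0 : ℝ) < M := by exact_mod_cast hM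
  have h2 : (M : ℝ) * D ≤ 2 ^ D := by exact_mod_cast h1
  have h3 : ((2 * M + 1 : ℕ) : ℝ) ^ d = D := by rw [hDdef]; push_cast; ring
  rw [h3, one_div, inv_pow, ← div_eq_mul_inv, ← one_div, div_le_div_iff₀ (by positivity) hM']
  linarith

theorem sum_inv_dyadic_le (d n : ℕ) : ∑ M ∈ dyadic d n, (M : ℝ)⁻¹ ≤ 2 := by
  rw [dyadic, Finset.sum_image fun a _ b _ h => Nat.pow_right_injective le_rfl h]
  have : ∀ j : ℕ, (((2 ^ j : ℕ) : ℝ))⁻¹ = (1 / 2) ^ j := fun j => by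
    push_cast
    rw [one_div, inv_pow]
  simp only [this]
  exact sum_geometric_two_le _

end Dyadic

section Rates

theorem exists_threshold {d β : ℕ} (hd : 1 ≤ d) (hβ : 1 ≤ β) (t : ℝ) :
    ∃ N : ℝ, 1 ≤ N ∧ ∀ y : ℝ, N ≤ y →
      3 * y ^ ((1 : ℝ) / (2 * β + d)) ≤ y ^ ((1 : ℝ) / d) ∧
      |t| * Real.logb 2 y ≤ y ^ ((d : ℝ) / (2 * β + d)) := by
  have hd' : (0 : ℝ) < d := by exact_mod_cast hd
  have hβ' : (0 : ℝ) < β := by exact_mod_cast hβ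
  have hδ : 0 < (1 : ℝ) / d - 1 / (2 * β + d) := by
    rw [sub_pos]
    exact one_div_lt_one_div_of_lt hd' (by linarith)
  have h1 := (tendsto_rpow_atTop hδ).eventually_ge_atTop 3
  have hl2 : 0 < Real.log 2 := Real.log_pos (by norm_num)
  have h2 := (isLittleO_log_rpow_atTop (by positivity : 0 < (d : ℝ) / (2 * β + d))).def
    (by positivity : 0 < Real.log 2 / (|t| + 1))
  obtain ⟨N, hN⟩ := Filter.eventually_atTop.1 (h1.and h2)
  refine ⟨max 1 N, le_max_left _ _, fun y hy => ?_⟩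
  have hy1 : 1 ≤ y := (le_max_left _ _).trans hy
  have hy0 : 0 < y := by linarith
  obtain ⟨h3, h4⟩ := hN y ((le_max_right _ _).trans hy)
  constructor
  · have : y ^ ((1 : ℝ) / d)
        = y ^ ((1 : ℝ) / d - 1 / (2 * β + d)) * y ^ ((1 : ℝ) / (2 * β + d)) := by
      rw [← Real.rpow_add hy0]
      congr 1
      ring
    rw [this]
    exact mul_le_mul_of_nonneg_right h3 (by positivity)
  · rw [Real.norm_of_nonneg (Real.log_nonneg hy1), Real.norm_of_nonneg (by positivity)] at h4
    rw [Real.logb, ← mul_div_assoc, div_le_iff₀ hl2]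
    have h5 : (|t| + 1) * Real.log y ≤ y ^ ((d : ℝ) / (2 * β + d)) * Real.log 2 := by
      rw [div_mul_eq_mul_div, le_div_iff₀ (by positivity)] at h4
      linarith
    nlinarith [Real.log_nonneg hy1]

variable {d β : ℕ} {y w : ℝ}

theorem pow_neg_min_rate_le (hy : 1 ≤ y) (hw : 1 ≤ w) :
    ((min (y ^ ((1 : ℝ) / (2 * β + d))) (w ^ ((1 : ℝ) / (β + d)))) ^ (2 * β))⁻¹
      ≤ max (y ^ (-(2 * (β : ℝ)) / (2 * β + d))) (w ^ (-(2 * (β : ℝ)) / (β + d))) := by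
  have key : ∀ {z s : ℝ}, 1 ≤ z →
      ((z ^ ((1 : ℝ) / s)) ^ (2 * β))⁻¹ = z ^ (-(2 * (β : ℝ)) / s) := fun {z s} hz => by
    have hz0 : 0 ≤ z := by linarith
    rw [← Real.rpow_natCast, ← Real.rpow_mul hz0, ← Real.rpow_neg hz0]
    congr 1
    push_cast
    ring
  rcases min_choice (y ^ ((1 : ℝ) / (2 * β + d))) (w ^ ((1 : ℝ) / (β + d))) with h | h
  · rw [h, key hy]
    exact le_max_left _ _
  · rw [h, key hw]
    exact le_max_right _ _

theorem pow_div_le_rate (hd : 1 ≤ d) (hy : 1 ≤ y) {x : ℝ} (hx0 : 0 ≤ x)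
    (hx : x ≤ y ^ ((1 : ℝ) / (2 * β + d))) :
    x ^ d / y ≤ y ^ (-(2 * (β : ℝ)) / (2 * β + d)) := by
  have hy0 : 0 < y := by linarith
  have hd' : (0 : ℝ) < d := by exact_mod_cast hd
  rw [div_le_iff₀ hy0]
  refine (pow_le_pow_left₀ hx0 hx d).trans (le_of_eq ?_)
  rw [← Real.rpow_natCast, ← Real.rpow_mul hy0.le, ← Real.rpow_add_one hy0.ne']
  congr 1
  field_simp
  ring

theorem pow_div_sq_le_rate (hd : 1 ≤ d) (hw : 1 ≤ w) {x : ℝ} (hx0 : 0 ≤ x)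
    (hx : x ≤ w ^ ((1 : ℝ) / (β + d))) :
    x ^ (2 * d) / w ^ 2 ≤ w ^ (-(2 * (β : ℝ)) / (β + d)) := by
  have hw0 : 0 < w := by linarith
  have hd' : (0 : ℝ) < d := by exact_mod_cast hd
  rw [div_le_iff₀ (by positivity)]
  refine (pow_le_pow_left₀ hx0 hx (2 * d)).trans (le_of_eq ?_)
  rw [← Real.rpow_natCast, ← Real.rpow_natCast, ← Real.rpow_mul hw0.le, ← Real.rpow_add hw0]
  congr 1
  push_cast
  field_simp
  ring

theorem rpow_div_eq_rate (hd : 1 ≤ d) (hy : 1 ≤ y) :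
    y ^ ((d : ℝ) / (2 * β + d)) / y = y ^ (-(2 * (β : ℝ)) / (2 * β + d)) := by
  have hy0 : 0 < y := by linarith
  have hd' : (0 : ℝ) < d := by exact_mod_cast hd
  rw [← Real.rpow_sub_one hy0.ne']
  congr 1
  field_simp
  ring

theorem inv_sq_le_rate (hd : 1 ≤ d) (hw : 1 ≤ w) :
    (w ^ 2)⁻¹ ≤ w ^ (-(2 * (β : ℝ)) / (β + d)) := by
  have h := pow_div_sq_le_rate (β := β) hd hw zero_le_one
    (Real.one_le_rpow hw (by positivity : 0 ≤ (1 : ℝ) / (β + d)))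
  rwa [one_pow, one_div] at h

end Rates

section Risk

variable {d n β : ℕ} {L ρ : ℝ} {f : (Fin d → ℝ) → ℝ}

theorem sum_integral_excess_le (hd : 1 ≤ d) (hn : 1 ≤ n) (hρ : 0 < ρ) (hf : IsDensity d f)
    (hb : eLpNorm (fun x => f x) ⊤ (volume.restrict (cube d)) < ⊤) :
    ∑ M ∈ dyadic d n, ∫ ω : SelSpace d n (dyadic d n), excess f ρ ω M
        ∂selMeasure d n (dyadic d n) f
      ≤ (dyadic d n).card * (2 * supNorm d f / (5 * n))
        + 128 / ((n : ℝ) ^ 2 * (ρ / (dyadic d n).card)) := by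
  have hn' : (0 : ℝ) < n := by exact_mod_cast hn
  set V := (n : ℝ) ^ 2 * (ρ / (dyadic d n).card) with hV
  have hV0 : 0 ≤ V := by positivity
  have hterm : ∀ M ∈ dyadic d n, ∫ ω : SelSpace d n (dyadic d n), excess f ρ ω M
        ∂selMeasure d n (dyadic d n) f
      ≤ 2 * supNorm d f / (5 * n) + 64 / V * (M : ℝ)⁻¹ := fun M hM => by
    refine (integral_excess_le hf hb hn hM).trans (add_le_add le_rfl ?_)
    rw [sigmaSel_sq d n _ hρ, ← hV]
    have h := mul_le_mul_of_nonneg_left (pow_mul_half_pow_le hd (one_le_of_mem_dyadic hM))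
      (by positivity : 0 ≤ 64 / V)
    refine le_trans (le_of_eq ?_) h
    ring
  refine (Finset.sum_le_sum hterm).trans ?_
  rw [Finset.sum_add_distrib, ← Finset.mul_sum, Finset.sum_const, nsmul_eq_mul]
  refine add_le_add le_rfl ?_
  refine (mul_le_mul_of_nonneg_left (sum_inv_dyadic_le d n) (by positivity)).trans (le_of_eq ?_)
  ring

/-- Oracle bound on the risk of the selected estimator. -/
theorem integral_l2sq_sub_selEstN_le (hn : 1 ≤ n) (hρ : 0 < ρ) (hβ : 1 ≤ β)
    (hf : IsDensity d f) (hS : SobolevP d β L f)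
    {Msel : SelSpace d n (dyadic d n) → ℕ} (hsel : IsSelectionRule d n (dyadic d n) ρ Msel)
    {M : ℕ} (hM : M ∈ dyadic d n) :
    ∫ ω, l2sq d (fun x => (f x : ℂ) - selEstN d n (dyadic d n) ρ (Msel ω) ω x)
        ∂selMeasure d n (dyadic d n) f
      ≤ 20 * (L ^ 2 * ((M : ℝ) ^ (2 * β))⁻¹) + 14 * lam2 d n (dyadic d n) ρ M
        + 14 * ∑ M' ∈ dyadic d n, ∫ ω : SelSpace d n (dyadic d n), excess f ρ ω M'
            ∂selMeasure d n (dyadic d n) f := by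
  have := isProbabilityMeasure_densMeasure hf
  have : IsProbabilityMeasure (selMeasure d n (dyadic d n) f) := by
    unfold selMeasure; infer_instance
  have hcont : Continuous fun x => (f x : ℂ) := Complex.continuous_ofReal.comp hS.1.continuous
  have hi : Integrable (fun ω : SelSpace d n (dyadic d n) =>
      14 * ∑ M' ∈ dyadic d n, excess f ρ ω M') (selMeasure d n (dyadic d n) f) :=
    (integrable_finsetSum _ fun M' _ => integrable_excess hf ρ M').const_mul _
  have hbias := l2sq_sub_projM_le hβ hS (one_le_of_mem_dyadic hM)
  refine (integral_mono_of_nonneg (Filter.Eventually.of_forall fun ω => l2sq_nonneg _ _)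
    ((integrable_const (20 * (L ^ 2 * ((M : ℝ) ^ (2 * β))⁻¹)
      + 14 * lam2 d n (dyadic d n) ρ M)).add hi)
    (Filter.Eventually.of_forall fun ω => ?_)).trans (le_of_eq ?_)
  · have h := oracle_inequality hρ (one_mem_dyadic d n) (fun M' hM' => one_le_of_mem_dyadic hM')
      (memLp_of_continuous hcont) ω (q := excess f ρ ω) (fun M' _ => excess_nonneg f ρ ω M')
      (fun M' hM' => two_mul_l2sq_projM_sub_selEstN_le hf hn hρ ω hM') (hsel.2 ω).1 hM
      ((hsel.2 ω).2 M hM)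
    refine h.trans ?_
    simp only [Pi.add_apply]
    linarith
  · simp only [Pi.add_apply]
    rw [integral_add (integrable_const _) hi, integral_const_mul,
      integral_finsetSum _ fun M' _ => integrable_excess hf ρ M']
    simp

end Risk

theorem lam2_le {d n : ℕ} {𝓜 : Finset ℕ} {ρ w x : ℝ} {M : ℕ} (hn : 1 ≤ n) (hw : 0 < w)
    (hwV : w ^ 2 ≤ (n : ℝ) ^ 2 * (ρ / 𝓜.card)) (hM : 1 ≤ M) (hMx : (M : ℝ) ≤ x) :
    lam2 d n 𝓜 ρ M ≤ 96 * 3 ^ d * (x ^ d / n) + 112 * 9 ^ d * (x ^ (2 * d) / w ^ 2) := by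
  have hM' : (1 : ℝ) ≤ M := by exact_mod_cast hM
  have hn' : (0 : ℝ) < n := by exact_mod_cast hn
  have h3 : ((2 * M + 1 : ℕ) : ℝ) ≤ 3 * x := by push_cast; linarith
  have h1 : ((2 * M + 1 : ℕ) : ℝ) ^ d ≤ 3 ^ d * x ^ d := by
    rw [← mul_pow]
    exact pow_le_pow_left₀ (by positivity) h3 d
  have h2 : ((2 * M + 1 : ℕ) : ℝ) ^ (2 * d) ≤ 9 ^ d * x ^ (2 * d) := by
    have : (9 : ℝ) ^ d = 3 ^ (2 * d) := by rw [pow_mul]; norm_num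
    rw [this, ← mul_pow]
    exact pow_le_pow_left₀ (by positivity) h3 _
  have h4 : ((2 * M + 1 : ℕ) : ℝ) ^ (2 * d) / ((n : ℝ) ^ 2 * (ρ / 𝓜.card))
      ≤ 9 ^ d * x ^ (2 * d) / w ^ 2 :=
    div_le_div₀ ((by positivity : (0 : ℝ) ≤ _).trans h2) h2 (by positivity) hwV
  have h5 : ((2 * M + 1 : ℕ) : ℝ) ^ d / n ≤ 3 ^ d * x ^ d / n := by gcongr
  have h6 : lam2 d n 𝓜 ρ M = 96 * (((2 * M + 1 : ℕ) : ℝ) ^ d / n)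
      + 112 * (((2 * M + 1 : ℕ) : ℝ) ^ (2 * d) / ((n : ℝ) ^ 2 * (ρ / 𝓜.card))) := by
    rw [lam2, lam1]; ring
  rw [h6, mul_assoc 96, mul_assoc 112, ← mul_div_assoc (3 ^ d), ← mul_div_assoc (9 ^ d)]
  linarith

/-- near-optimal adaptive rate of the penalized-bias selection.
There are `C₁ > 0` depending only on `β, L, d` and `C₂ > 0` depending only on
`β, d, ‖f‖_∞` such that for every bounded density `f ∈ S_L^p(β)` and all `n, ρ` with
`min{n, n√(ρ/log₂ n)} ≥ C₂`, the estimator selected by the penalized-bias rule over the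
dyadic collection satisfies
`E‖f - f̂_{M̂}‖² ≤ C₁ max{ n^{-2β/(2β+d)}, (n√ρ/√(log₂ n))^{-2β/(β+d)} }`. -/
theorem stmt11 (d β : ℕ) (hd : 1 ≤ d) (hβ : 1 ≤ β) (L : ℝ) (hL : 0 < L) :
    ∃ C₁ > (0 : ℝ), ∃ C₂ : ℝ → ℝ, (∀ t, 0 < C₂ t) ∧
      ∀ f : (Fin d → ℝ) → ℝ, IsDensity d f →
        eLpNorm (fun x => f x) ⊤ (volume.restrict (cube d)) < ⊤ →
        SobolevP d β L f →
        ∀ (n : ℕ) (ρ : ℝ), 1 ≤ n → 0 < ρ →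
          C₂ (supNorm d f) ≤ min (n : ℝ) ((n : ℝ) * Real.sqrt (ρ / Real.logb 2 n)) →
          ∀ Msel : SelSpace d n (dyadic d n) → ℕ,
            IsSelectionRule d n (dyadic d n) ρ Msel →
            (∫ ω, l2sq d (fun x => (f x : ℂ) - selEstN d n (dyadic d n) ρ (Msel ω) ω x)
                ∂ selMeasure d n (dyadic d n) f)
              ≤ C₁ * max ((n : ℝ) ^ (-(2 * (β : ℝ)) / (2 * β + d)))
                  (((n : ℝ) * Real.sqrt ρ / Real.sqrt (Real.logb 2 n))
                    ^ (-(2 * (β : ℝ)) / (β + d))) := by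
  choose C₂ hC₂ hrate using fun t => exists_threshold hd hβ t
  refine ⟨20 * L ^ 2 * 2 ^ (2 * β) + 14 * (96 * 3 ^ d + 112 * 9 ^ d) + 14 * 129, by positivity,
    C₂, fun t => one_pos.trans_le (hC₂ t), fun f hf hb hS n ρ hn hρ hmin Msel hsel => ?_⟩
  obtain ⟨hn2, hw2⟩ := le_min_iff.1 hmin
  obtain ⟨hr1, hr2⟩ := hrate _ _ hn2
  have hn1 : (1 : ℝ) ≤ n := by exact_mod_cast hn
  have hn0 : (0 : ℝ) < n := by linarith
  set w := (n : ℝ) * Real.sqrt ρ / Real.sqrt (Real.logb 2 n) with hwdef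
  have hw1 : 1 ≤ w := by
    have h := (hC₂ _).trans hw2
    rwa [Real.sqrt_div hρ.le, ← mul_div_assoc] at h
  have hw0 : 0 < w := by linarith
  have hyd : 1 ≤ (n : ℝ) ^ ((1 : ℝ) / (2 * β + d)) := Real.one_le_rpow hn1 (by positivity)
  have hcard := card_dyadic_le hd (by linarith)
  have hcard0 : (0 : ℝ) < (dyadic d n).card := by
    exact_mod_cast Finset.card_pos.2 ⟨1, one_mem_dyadic d n⟩
  have hwV : w ^ 2 ≤ (n : ℝ) ^ 2 * (ρ / (dyadic d n).card) := by
    rw [hwdef, div_pow, mul_pow, Real.sq_sqrt hρ.le, Real.sq_sqrt (hcard0.le.trans hcard),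
      mul_div_assoc]
    gcongr
  set x := min ((n : ℝ) ^ ((1 : ℝ) / (2 * β + d))) (w ^ ((1 : ℝ) / (β + d))) with hx
  have hx1 : 1 ≤ x := le_min hyd (Real.one_le_rpow hw1 (by positivity))
  obtain ⟨M, hM, hMx, hxM⟩ := exists_mem_dyadic (d := d) (n := n) hx1 (by
    have := min_le_left ((n : ℝ) ^ ((1 : ℝ) / (2 * β + d))) (w ^ ((1 : ℝ) / (β + d)))
    linarith)
  have hbias : ((M : ℝ) ^ (2 * β))⁻¹ ≤ 2 ^ (2 * β) * (x ^ (2 * β))⁻¹ := by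
    have hM0 : (0 : ℝ) < M := by linarith
    rw [← div_eq_mul_inv, inv_eq_one_div, div_le_div_iff₀ (by positivity) (by positivity), one_mul,
      ← mul_pow]
    exact pow_le_pow_left₀ (by linarith) hxM _
  have hmain := integral_l2sq_sub_selEstN_le hn hρ hβ hf hS hsel hM
  have hex := sum_integral_excess_le hd hn hρ hf hb
  have hlam := lam2_le (d := d) hn hw0 hwV (one_le_of_mem_dyadic hM) hMx
  have hR0 := pow_neg_min_rate_le (β := β) (d := d) hn1 hw1
  have hRa := pow_div_le_rate (β := β) hd hn1 (by linarith) (min_le_left _ _ : x ≤ _)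
  have hRb := pow_div_sq_le_rate (β := β) hd hw1 (by linarith) (min_le_right _ _ : x ≤ _)
  have hRc := inv_sq_le_rate (β := β) hd hw1
  have hRd := rpow_div_eq_rate (β := β) hd hn1
  rw [← hx] at hR0
  set a := (n : ℝ) ^ (-(2 * (β : ℝ)) / (2 * β + d))
  set b := w ^ (-(2 * (β : ℝ)) / (β + d))
  have ha := le_max_left a b
  have hb' := le_max_right a b
  set m := max a b
  have hE1 : (dyadic d n).card * (2 * supNorm d f / (5 * n)) ≤ m := by
    have hA := supNorm_nonneg d f
    rw [abs_of_nonneg hA] at hr2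
    have h1 : supNorm d f * (dyadic d n).card ≤ (n : ℝ) ^ ((d : ℝ) / (2 * β + d)) :=
      (mul_le_mul_of_nonneg_left hcard hA).trans hr2
    have h2 : supNorm d f * (dyadic d n).card / n ≤ a := by
      rw [← hRd]
      gcongr
    have h3 : (dyadic d n).card * (2 * supNorm d f / (5 * n))
        = 2 / 5 * (supNorm d f * (dyadic d n).card / n) := by
      field_simp
    have h4 : 0 ≤ supNorm d f * (dyadic d n).card / n := by positivity
    rw [h3]
    linarith
  have hE2 : 128 / ((n : ℝ) ^ 2 * (ρ / (dyadic d n).card)) ≤ 128 * m := by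
    have h1 : 128 / ((n : ℝ) ^ 2 * (ρ / (dyadic d n).card)) ≤ 128 / w ^ 2 := by gcongr
    rw [div_eq_mul_inv 128 (w ^ 2)] at h1
    linarith
  have hL1 : L ^ 2 * ((M : ℝ) ^ (2 * β))⁻¹ ≤ L ^ 2 * 2 ^ (2 * β) * m := by
    rw [mul_assoc]
    exact mul_le_mul_of_nonneg_left
      (hbias.trans (mul_le_mul_of_nonneg_left hR0 (by positivity))) (sq_nonneg L)
  have hL2 : lam2 d n (dyadic d n) ρ M ≤ (96 * 3 ^ d + 112 * 9 ^ d) * m := by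
    rw [add_mul]
    refine hlam.trans (add_le_add ?_ ?_)
    · exact mul_le_mul_of_nonneg_left (hRa.trans ha) (by positivity)
    · exact mul_le_mul_of_nonneg_left (hRb.trans hb') (by positivity)
  linarith

end
end

section
/- In the packing setup, assume h ≤ 1/(2(m+1)) and 4·m^d·h^d·γ² ≤ δ. Then for all θ₁, θ₂ ∈ {0,1}^{m^d}, ∫_{[0,1]^d} ( f_{θ₁}(x) − f_{θ₂}(x) )² dx ≥ Ham(θ₁, θ₂) · h^{2β+d} · δ / 2. -/
open MeasureTheory Real Finset

noncomputable section

/-- The grid point `p_η = ((η₁+1)/(m+1), …, (η_d+1)/(m+1))` for `η ∈ {0,…,m-1}^d`;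
this enumerates the grid `{1/(m+1), …, m/(m+1)}^d`. -/
def gridPt (d m : ℕ) (η : Fin d → Fin m) : Fin d → ℝ := fun i => ((η i : ℝ) + 1) / (m + 1)

/-- The packing density
`f_θ(x) = 1 + h^β Σ_η θ_η ψ((x - p_η)/h) - ‖θ‖₁ γ h^{β+d}`, where `γ = ∫ ψ`. -/
def packDensity (d m : ℕ) (β h : ℝ) (ψ : (Fin d → ℝ) → ℝ)
    (θ : (Fin d → Fin m) → Bool) (x : Fin d → ℝ) : ℝ :=
  1 + h ^ β * ∑ η : Fin d → Fin m,
      (if θ η then (1 : ℝ) else 0) * ψ (fun i => (x i - gridPt d m η i) / h)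
    - (∑ η : Fin d → Fin m, if θ η then (1 : ℝ) else 0) * (∫ y : Fin d → ℝ, ψ y) *
        h ^ (β + d)

/-- Hamming distance between two parameters `θ₁, θ₂ ∈ {0,1}^{m^d}`. -/
def hamB (d m : ℕ) (θ₁ θ₂ : (Fin d → Fin m) → Bool) : ℕ :=
  (Finset.univ.filter fun η => θ₁ η ≠ θ₂ η).card

/-- A rescaled bump `x ↦ F ((x - p) / h)`. -/
def rescale {d : ℕ} (F : (Fin d → ℝ) → ℝ) (h : ℝ) (p x : Fin d → ℝ) : ℝ :=
  F fun i => (x i - p i) / h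

lemma rescale_eq {d : ℕ} (F : (Fin d → ℝ) → ℝ) (h : ℝ) (p x : Fin d → ℝ) :
    rescale F h p x = F (h⁻¹ • (x - p)) := by
  unfold rescale
  congr 1
  ext i
  simp [div_eq_inv_mul]

lemma integral_rescale {d : ℕ} (F : (Fin d → ℝ) → ℝ) {h : ℝ} (hh : 0 < h) (p : Fin d → ℝ) :
    ∫ x, rescale F h p x = h ^ d * ∫ y, F y := by
  simp_rw [rescale_eq]
  rw [integral_sub_right_eq_self (fun x => F (h⁻¹ • x)) p, Measure.integral_comp_inv_smul]
  simp [abs_of_pos hh]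

lemma continuous_rescale {d : ℕ} {F : (Fin d → ℝ) → ℝ} (hF : Continuous F) (h : ℝ)
    (p : Fin d → ℝ) : Continuous (rescale F h p) := by
  unfold rescale
  fun_prop

lemma abs_sub_lt_of_rescale_ne_zero {d : ℕ} {F : (Fin d → ℝ) → ℝ}
    (hF : ∀ x : Fin d → ℝ, 1 ≤ ∑ i, x i ^ 2 → F x = 0) {h : ℝ} (hh : 0 < h)
    {p x : Fin d → ℝ} (hx : rescale F h p x ≠ 0) (i : Fin d) : |x i - p i| < h := by
  have h1 : ∑ i, ((x i - p i) / h) ^ 2 < 1 := by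
    by_contra hcon
    exact hx (hF _ (not_lt.mp hcon))
  have h2 : ((x i - p i) / h) ^ 2 < 1 :=
    (single_le_sum (f := fun i => ((x i - p i) / h) ^ 2)
      (fun i _ => sq_nonneg _) (mem_univ i)).trans_lt h1
  rw [sq_lt_one_iff_abs_lt_one, abs_div, abs_of_pos hh, div_lt_one hh] at h2
  exact h2

lemma two_mul_le_one_of_le {m : ℕ} {h : ℝ} (hh1 : h ≤ 1 / (2 * ((m : ℝ) + 1))) :
    2 * h * ((m : ℝ) + 1) ≤ 1 := by
  rw [le_div_iff₀ (by positivity)] at hh1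
  linarith

lemma mem_cube_of_abs_sub_gridPt_lt {d m : ℕ} {h : ℝ}
    (hh1 : h ≤ 1 / (2 * ((m : ℝ) + 1))) {η : Fin d → Fin m} {x : Fin d → ℝ}
    (hx : ∀ i, |x i - gridPt d m η i| < h) : x ∈ cube d := by
  have key := two_mul_le_one_of_le hh1
  have hm : (0 : ℝ) < m + 1 := by positivity
  have hhm : h * (m + 1) ≤ 1 := by nlinarith
  have hle : h ≤ 1 / ((m : ℝ) + 1) := by rwa [le_div_iff₀ hm]
  have bounds : ∀ i, 0 ≤ x i ∧ x i ≤ 1 := fun i => by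
    have h1 := abs_lt.mp (hx i)
    have h2 : 1 / ((m : ℝ) + 1) ≤ gridPt d m η i := by
      unfold gridPt
      gcongr
      linarith [(Nat.cast_nonneg (η i : ℕ) : (0 : ℝ) ≤ _)]
    have h3 : gridPt d m η i ≤ 1 - 1 / ((m : ℝ) + 1) := by
      have : ((η i : ℕ) : ℝ) + 1 ≤ m := by exact_mod_cast (η i).2
      unfold gridPt
      rw [le_sub_iff_add_le, ← add_div, div_le_one hm]
      linarith
    constructor <;> linarith
  exact ⟨fun i => (bounds i).1, fun i => (bounds i).2⟩

lemma eq_of_abs_sub_gridPt_lt {d m : ℕ} {h : ℝ}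
    (hh1 : h ≤ 1 / (2 * ((m : ℝ) + 1))) {η ζ : Fin d → Fin m} {x : Fin d → ℝ}
    (hη : ∀ i, |x i - gridPt d m η i| < h) (hζ : ∀ i, |x i - gridPt d m ζ i| < h) :
    η = ζ := by
  ext i
  have key := two_mul_le_one_of_le hh1
  have hm : (0 : ℝ) < m + 1 := by positivity
  have h1 : |gridPt d m η i - gridPt d m ζ i| < 2 * h := by
    have h2 := abs_lt.mp (hη i)
    have h3 := abs_lt.mp (hζ i)
    rw [abs_lt]
    constructor <;> linarith
  have h4 : gridPt d m η i - gridPt d m ζ i = ((η i : ℝ) - ζ i) / (m + 1) := by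
    unfold gridPt
    ring
  rw [h4, abs_div, abs_of_pos hm, div_lt_iff₀ hm] at h1
  have h5 : |((η i : ℕ) : ℤ) - (ζ i : ℕ)| < 1 := by
    exact_mod_cast h1.trans_le key
  have := Int.abs_lt_one_iff.mp h5
  omega

/-- For a constant `C` and a function `g` supported in the unit cube,
`∫_{[0,1]^d} (a g - C)² = a² ∫ g² - 2 a C ∫ g + C²`. -/
lemma setIntegral_cube_sq {d : ℕ} {g : (Fin d → ℝ) → ℝ} (hg : Continuous g)
    (hsupp : ∀ x, x ∉ cube d → g x = 0) (a C : ℝ) :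
    ∫ x in cube d, (a * g x - C) ^ 2
      = a ^ 2 * (∫ x, g x ^ 2) - 2 * a * C * (∫ x, g x) + C ^ 2 := by
  have hcpt : IsCompact (cube d) := isCompact_Icc
  have hvol : volume.real (cube d) = 1 := by
    simp [cube, Measure.real, Real.volume_Icc_pi]
  have i1 : IntegrableOn (fun x => a ^ 2 * g x ^ 2) (cube d) :=
    Continuous.continuousOn (by fun_prop) |>.integrableOn_compact hcpt
  have i2 : IntegrableOn (fun x => 2 * a * C * g x) (cube d) :=
    Continuous.continuousOn (by fun_prop) |>.integrableOn_compact hcpt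
  have i12 : IntegrableOn (fun x => a ^ 2 * g x ^ 2 - 2 * a * C * g x) (cube d) := i1.sub i2
  have i3 : IntegrableOn (fun _ : Fin d → ℝ => C ^ 2) (cube d) :=
    continuousOn_const.integrableOn_compact hcpt
  have e : ∀ x, (a * g x - C) ^ 2 = a ^ 2 * g x ^ 2 - 2 * a * C * g x + C ^ 2 :=
    fun x => by ring
  simp_rw [e]
  rw [integral_add i12 i3, integral_sub i1 i2, integral_const_mul, integral_const_mul,
    setIntegral_eq_integral_of_forall_compl_eq_zero hsupp,
    setIntegral_eq_integral_of_forall_compl_eq_zero fun x hx => by rw [hsupp x hx]; simp]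
  simp [hvol]

lemma sum_sq_of_pairwise_mul_eq_zero {ι : Type*} [Fintype ι] (a : ι → ℝ)
    (ha : ∀ i j, i ≠ j → a i * a j = 0) : (∑ i, a i) ^ 2 = ∑ i, a i ^ 2 := by
  rw [sq, sum_mul_sum]
  refine sum_congr rfl fun i _ => ?_
  rw [sum_eq_single i (fun j _ hj => ha i j hj.symm) (by simp), sq]

/-- L² separation of the packing family. In the packing setup, if
`h ≤ 1/(2(m+1))` and `4 m^d h^d γ² ≤ δ`, then for all `θ₁, θ₂ ∈ {0,1}^{m^d}`,
`∫_{[0,1]^d} (f_{θ₁} - f_{θ₂})² ≥ Ham(θ₁,θ₂) h^{2β+d} δ / 2`, where `γ = ∫ψ`, `δ = ∫ψ²`. -/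
theorem stmt18 (d m : ℕ) (hd : 1 ≤ d) (hm : 1 ≤ m) (β : ℝ) (hβ : 0 < β)
    (ψ : (Fin d → ℝ) → ℝ) (hψc : Continuous ψ) (hψ0 : ∀ x, 0 ≤ ψ x)
    (hψne : ∃ x, ψ x ≠ 0)
    (hψsupp : ∀ x : Fin d → ℝ, 1 ≤ ∑ i, x i ^ 2 → ψ x = 0)
    (h : ℝ) (hh0 : 0 < h) (hh1 : h ≤ 1 / (2 * ((m : ℝ) + 1)))
    (hsmall : 4 * (m : ℝ) ^ d * h ^ (d : ℝ) * (∫ y : Fin d → ℝ, ψ y) ^ 2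
      ≤ ∫ y : Fin d → ℝ, ψ y ^ 2)
    (θ₁ θ₂ : (Fin d → Fin m) → Bool) :
    (hamB d m θ₁ θ₂ : ℝ) * h ^ (2 * β + d) * (∫ y : Fin d → ℝ, ψ y ^ 2) / 2
      ≤ ∫ x in cube d, (packDensity d m β h ψ θ₁ x - packDensity d m β h ψ θ₂ x) ^ 2 := by
  set γ := ∫ y, ψ y
  set δ := ∫ y, ψ y ^ 2
  let c : (Fin d → Fin m) → ℝ := fun η => (if θ₁ η then (1 : ℝ) else 0) - if θ₂ η then 1 else 0
  let b : (Fin d → Fin m) → (Fin d → ℝ) → ℝ := fun η => rescale ψ h (gridPt d m η)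
  let g : (Fin d → ℝ) → ℝ := fun x => ∑ η, c η * b η x
  have hbc : ∀ η, Continuous (b η) := fun η => continuous_rescale hψc h _
  have hnear : ∀ η x, b η x ≠ 0 → ∀ i, |x i - gridPt d m η i| < h := fun η x hx =>
    abs_sub_lt_of_rescale_ne_zero hψsupp hh0 hx
  have hb0 : ∀ η x, x ∉ cube d → b η x = 0 := fun η x hx => by
    by_contra hne
    exact hx (mem_cube_of_abs_sub_gridPt_lt hh1 (hnear η x hne))
  have hbdisj : ∀ η ζ, η ≠ ζ → ∀ x, b η x * b ζ x = 0 := fun η ζ hne x => by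
    by_contra hprod
    exact hne (eq_of_abs_sub_gridPt_lt hh1 (hnear η x (left_ne_zero_of_mul hprod))
      (hnear ζ x (right_ne_zero_of_mul hprod)))
  have hbcs : ∀ η, HasCompactSupport (b η) := fun η =>
    HasCompactSupport.intro (isCompact_Icc : IsCompact (cube d)) fun x hx => hb0 η x hx
  have hint1 : ∫ x, g x = (∑ η, c η) * (h ^ d * γ) := by
    simp only [g]
    rw [integral_finsetSum _ fun η _ =>
      ((hbc η).integrable_of_hasCompactSupport (hbcs η)).const_mul _, sum_mul]
    refine sum_congr rfl fun η _ => ?_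
    rw [integral_const_mul, integral_rescale ψ hh0]
  have hgsq : ∀ x, g x ^ 2 = ∑ η, c η ^ 2 * b η x ^ 2 := fun x => by
    simp only [g]
    rw [sum_sq_of_pairwise_mul_eq_zero]
    · simp only [mul_pow]
    · intro η ζ hne
      linear_combination c η * c ζ * hbdisj η ζ hne x
  have hint2 : ∫ x, g x ^ 2 = (∑ η, c η ^ 2) * (h ^ d * δ) := by
    have hbint : ∀ η, Integrable fun x => b η x ^ 2 := fun η =>
      ((hbc η).pow 2).integrable_of_hasCompactSupport
        (HasCompactSupport.intro (isCompact_Icc : IsCompact (cube d))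
          fun x hx => by simp [hb0 η x hx])
    simp_rw [hgsq]
    rw [integral_finsetSum _ fun η _ => (hbint η).const_mul _, sum_mul]
    refine sum_congr rfl fun η _ => ?_
    rw [integral_const_mul]
    congr 1
    exact integral_rescale (fun y => ψ y ^ 2) hh0 (gridPt d m η)
  have hdiff : ∀ x, packDensity d m β h ψ θ₁ x - packDensity d m β h ψ θ₂ x
      = h ^ β * g x - (∑ η, c η) * γ * h ^ (β + d) := fun x => by
    simp only [packDensity, g, c, b, rescale, sub_mul, sum_sub_distrib]
    ring
  have hcN : ∑ η, c η ^ 2 = hamB d m θ₁ θ₂ := by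
    rw [hamB, card_filter]
    push_cast
    refine sum_congr rfl fun η _ => ?_
    simp only [c]
    cases θ₁ η <;> cases θ₂ η <;> simp
  have hcabs : |∑ η, c η| ≤ hamB d m θ₁ θ₂ := by
    rw [← hcN]
    refine (abs_sum_le_sum_abs _ _).trans (sum_le_sum fun η _ => ?_)
    simp only [c]
    cases θ₁ η <;> cases θ₂ η <;> simp
  have hNle : (hamB d m θ₁ θ₂ : ℝ) ≤ (m : ℝ) ^ d := by
    have : hamB d m θ₁ θ₂ ≤ m ^ d := (card_filter_le _ _).trans (by simp)
    exact_mod_cast this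
  have hgc : Continuous g := by fun_prop
  have hg0 : ∀ x, x ∉ cube d → g x = 0 := fun x hx => by simp [g, hb0 _ x hx]
  simp_rw [hdiff]
  rw [setIntegral_cube_sq hgc hg0, hint1, hint2, hcN, Real.rpow_add hh0, Real.rpow_add hh0,
    two_mul β, Real.rpow_add hh0, Real.rpow_natCast]
  rw [Real.rpow_natCast] at hsmall
  generalize (∑ η, c η) = S at *
  generalize (hamB d m θ₁ θ₂ : ℝ) = N at *
  have hN0 : 0 ≤ N := (abs_nonneg S).trans hcabs
  have hSN : S ^ 2 ≤ N * (m : ℝ) ^ d := by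
    have h1 : S ^ 2 ≤ N ^ 2 := sq_le_sq' (abs_le.mp hcabs).1 (abs_le.mp hcabs).2
    nlinarith
  have hhd : 0 < h ^ d := by positivity
  have hδ : 0 ≤ δ := integral_nonneg fun y => sq_nonneg _
  have hbound : S ^ 2 * (h ^ d * γ ^ 2) ≤ N * δ / 2 := by
    have h1 : S ^ 2 * (h ^ d * γ ^ 2) ≤ N * (m : ℝ) ^ d * (h ^ d * γ ^ 2) := by gcongr
    have h2 := mul_le_mul_of_nonneg_left hsmall hN0
    have h3 := mul_nonneg hN0 hδ
    linarith
  have hpos : 0 ≤ (h ^ β) ^ 2 * h ^ d := by positivity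
  have := mul_le_mul_of_nonneg_left hbound hpos
  linarith

end
end
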